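/- arXiv:0811.2935 — 3 statements merged into one kernel-verified Lean document; each statement's English description precedes it below -/
import Mathlib

section
/- Let s be an integer and let f = (f_R)_{R∈SO(3)} be a continuous spin-s function on S². Then the function (θ,φ) ↦ e^{isφ} f_I(θ,φ) extends continuously from U_I to U_I ∪ {N}; that is, lim_{θ→0⁺} e^{isφ} f_I(θ,φ) exists, is independent of φ, and the convergence is uniform in φ. Similarly, (θ,φ) ↦ e^{−isφ} f_I(θ,φ) extends continuously from U_I to U_I ∪ {S}, i.e. lim_{θ→π⁻} e^{−isφ} f_I(θ,φ) exists, is independent of φ, and the convergence is uniform in φ. -/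
noncomputable section

/-- Euclidean dot product on `ℝ³`. -/
def dot3 (v w : Fin 3 → ℝ) : ℝ := v 0 * w 0 + v 1 * w 1 + v 2 * w 2

/-- The set of special orthogonal `3×3` matrices (rotations). -/
def SO3set : Set (Matrix (Fin 3) (Fin 3) ℝ) := {R | R * R.transpose = 1 ∧ R.det = 1}

/-- The north pole. -/
def NP : Fin 3 → ℝ := ![0, 0, 1]

/-- The south pole. -/
def SP : Fin 3 → ℝ := ![0, 0, -1]

/-- `U_I = S² ∖ {N, S}`. -/
def UI : Set (Fin 3 → ℝ) := {p | dot3 p p = 1 ∧ p ≠ NP ∧ p ≠ SP}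

/-- The chart `U_R = R · U_I`; `p ∈ U_R ↔ R⁻¹ p ∈ U_I` (with `R⁻¹ = Rᵀ`). -/
def chartU (R : Matrix (Fin 3) (Fin 3) ℝ) : Set (Fin 3 → ℝ) :=
  {p | Matrix.mulVec R.transpose p ∈ UI}

/-- The reference direction `ρ_I(p) = (−y, x, 0)/√(x²+y²)`. -/
noncomputable def rhoI (p : Fin 3 → ℝ) : Fin 3 → ℝ :=
  (Real.sqrt (p 0 ^ 2 + p 1 ^ 2))⁻¹ • ![-(p 1), p 0, 0]

/-- The reference direction `ρ_R(p) = R · ρ_I(R⁻¹ p)` on the chart `U_R`. -/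
noncomputable def rhoR (R : Matrix (Fin 3) (Fin 3) ℝ) (p : Fin 3 → ℝ) : Fin 3 → ℝ :=
  Matrix.mulVec R (rhoI (Matrix.mulVec R.transpose p))

/-- The spin-`s` transformation law: whenever `ψ ∈ (−π, π]` satisfies
`ρ_{R₂}(p) = cos ψ · ρ_{R₁}(p) + sin ψ · (ρ_{R₁}(p) × p)` (i.e. `ψ` is the oriented angle from
`ρ_{R₁}(p)` to `ρ_{R₂}(p)`), one has `f_{R₂}(p) = e^{isψ} f_{R₁}(p)`. -/
def IsSpinFamily (s : ℤ) (f : Matrix (Fin 3) (Fin 3) ℝ → (Fin 3 → ℝ) → ℂ) : Prop :=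
  ∀ R₁ ∈ SO3set, ∀ R₂ ∈ SO3set, ∀ p ∈ chartU R₁ ∩ chartU R₂,
    ∀ ψ ∈ Set.Ioc (-Real.pi) Real.pi,
      rhoR R₂ p = Real.cos ψ • rhoR R₁ p + Real.sin ψ • (crossProduct (rhoR R₁ p) p) →
        f R₂ p = Complex.exp (Complex.I * (s : ℂ) * (ψ : ℂ)) * f R₁ p

/-- Standard spherical coordinates. -/
noncomputable def sphCoords (θ φ : ℝ) : Fin 3 → ℝ :=
  ![Real.sin θ * Real.cos φ, Real.sin θ * Real.sin φ, Real.cos θ]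

open Filter Topology

/-- The rotation permuting the coordinate axes cyclically, whose chart contains both poles. -/
def cyclicRot : Matrix (Fin 3) (Fin 3) ℝ := !![0, 0, 1; 1, 0, 0; 0, 1, 0]

theorem cyclicRot_mem_SO3set : cyclicRot ∈ SO3set := by
  refine ⟨?_, ?_⟩
  · ext i j
    fin_cases i <;> fin_cases j <;> simp [cyclicRot, Matrix.mul_apply, Fin.sum_univ_three]
  · simp [cyclicRot, Matrix.det_fin_three]

theorem one_mem_SO3set : (1 : Matrix (Fin 3) (Fin 3) ℝ) ∈ SO3set := by
  simp [SO3set]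

theorem cyclicRot_transpose_mulVec (p : Fin 3 → ℝ) :
    cyclicRot.transpose.mulVec p = ![p 1, p 2, p 0] := by
  ext i
  fin_cases i <;> simp [cyclicRot, Matrix.mulVec, dotProduct, Fin.sum_univ_three]

theorem mem_UI_of_abs_lt {p : Fin 3 → ℝ} (hp : dot3 p p = 1) (hz : |p 2| < 1) : p ∈ UI := by
  refine ⟨hp, ?_, ?_⟩ <;> rintro rfl <;> simp [NP, SP] at hz

theorem mem_chartU_cyclicRot {p : Fin 3 → ℝ} (hp : dot3 p p = 1) (hx : |p 0| < 1) :
    p ∈ chartU cyclicRot := by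
  rw [chartU, Set.mem_ofPred_eq, cyclicRot_transpose_mulVec]
  refine mem_UI_of_abs_lt ?_ (by simpa using hx)
  simp only [dot3] at hp ⊢
  simp
  linarith

theorem dot3_sphCoords (θ φ : ℝ) : dot3 (sphCoords θ φ) (sphCoords θ φ) = 1 := by
  simp [dot3, sphCoords]
  linear_combination (Real.sin θ ^ 2) * Real.sin_sq_add_cos_sq φ + Real.sin_sq_add_cos_sq θ

theorem rhoR_one_sphCoords {θ : ℝ} (hθ : 0 < Real.sin θ) (φ : ℝ) :
    rhoR 1 (sphCoords θ φ) = ![-Real.sin φ, Real.cos φ, 0] := by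
  have h : Real.sqrt ((Real.sin θ * Real.cos φ) ^ 2 + (Real.sin θ * Real.sin φ) ^ 2)
      = Real.sin θ := by
    rw [← Real.sqrt_sq hθ.le]
    congr 1
    rw [Real.sqrt_sq hθ.le]
    linear_combination (Real.sin θ ^ 2) * Real.sin_sq_add_cos_sq φ
  ext i
  fin_cases i <;> simp [rhoR, rhoI, sphCoords, h] <;> field_simp

/-- The distance of the point with spherical coordinates `θ, φ` from the first axis. -/
def axisDist (θ φ : ℝ) : ℝ :=
  Real.sqrt ((Real.sin θ * Real.sin φ) ^ 2 + Real.cos θ ^ 2)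

theorem rhoR_cyclicRot_sphCoords (θ φ : ℝ) :
    rhoR cyclicRot (sphCoords θ φ)
      = (axisDist θ φ)⁻¹ • ![0, -Real.cos θ, Real.sin θ * Real.sin φ] := by
  rw [rhoR, cyclicRot_transpose_mulVec]
  ext i
  fin_cases i <;>
    simp [rhoI, sphCoords, axisDist, cyclicRot, Matrix.mulVec, dotProduct, Fin.sum_univ_three]

/-- The phase `e^{iψ}` of the oriented angle from `ρ_I` to `ρ_R` for `R = cyclicRot`. -/
def cyclicPhase (θ φ : ℝ) : ℂ :=
  ⟨-(Real.cos θ * Real.cos φ) / axisDist θ φ, -Real.sin φ / axisDist θ φ⟩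

theorem axisDist_sq (θ φ : ℝ) :
    axisDist θ φ ^ 2 = (Real.cos θ * Real.cos φ) ^ 2 + Real.sin φ ^ 2 := by
  rw [axisDist, Real.sq_sqrt (by positivity)]
  linear_combination (Real.sin φ ^ 2) * Real.sin_sq_add_cos_sq θ
    - (Real.cos θ ^ 2) * Real.sin_sq_add_cos_sq φ

theorem norm_cyclicPhase {θ φ : ℝ} (hD : axisDist θ φ ≠ 0) : ‖cyclicPhase θ φ‖ = 1 := by
  rw [← sq_eq_sq₀ (norm_nonneg _) zero_le_one, Complex.sq_norm, Complex.normSq_apply]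
  simp only [cyclicPhase]
  field_simp
  linear_combination -axisDist_sq θ φ

theorem spin_cyclicRot_eq {s : ℤ} {f : Matrix (Fin 3) (Fin 3) ℝ → (Fin 3 → ℝ) → ℂ}
    (hspin : IsSpinFamily s f) {θ φ : ℝ} (hθ : 0 < Real.sin θ) (hθ' : Real.sin θ < 1)
    (hD : axisDist θ φ ≠ 0) :
    f cyclicRot (sphCoords θ φ) = cyclicPhase θ φ ^ s * f 1 (sphCoords θ φ) := by
  have hp := dot3_sphCoords θ φ
  have hx : |sphCoords θ φ 0| < 1 := by
    simp only [sphCoords, Matrix.cons_val_zero, abs_mul, abs_of_pos hθ]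
    exact (mul_le_of_le_one_right hθ.le (Real.abs_cos_le_one φ)).trans_lt hθ'
  have hz : |sphCoords θ φ 2| < 1 := by
    simp only [sphCoords, Matrix.cons_val]
    rw [← sq_lt_one_iff_abs_lt_one]
    nlinarith [Real.sin_sq_add_cos_sq θ, pow_pos hθ 2]
  have hnorm := norm_cyclicPhase hD
  have hne : cyclicPhase θ φ ≠ 0 := norm_ne_zero_iff.mp (by simp [hnorm])
  have key := hspin 1 one_mem_SO3set cyclicRot cyclicRot_mem_SO3set (sphCoords θ φ)
    ⟨by simpa [chartU] using mem_UI_of_abs_lt hp hz, mem_chartU_cyclicRot hp hx⟩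
    (cyclicPhase θ φ).arg (Complex.arg_mem_Ioc _) ?_
  · have hexp := Complex.norm_mul_exp_arg_mul_I (cyclicPhase θ φ)
    rw [hnorm, Complex.ofReal_one, one_mul] at hexp
    rw [key, ← hexp, ← Complex.exp_int_mul, hexp]
    ring_nf
  · rw [Complex.cos_arg hne, Complex.sin_arg, hnorm, rhoR_one_sphCoords hθ,
      rhoR_cyclicRot_sphCoords]
    have h1 := Real.sin_sq_add_cos_sq φ
    ext i
    fin_cases i <;> simp [cyclicPhase, sphCoords, crossProduct] <;> field_simp
    · ring
    · linear_combination Real.cos θ * h1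
    · linear_combination (-Real.sin φ) * h1

/-- The phase `e^{iσφ}` divided by `cyclicPhase θ φ`, for `σ = ±1`. -/
def poleTransition (σ θ φ : ℝ) : ℂ :=
  ⟨-(σ + (Real.cos θ - σ) * Real.cos φ ^ 2) / axisDist θ φ,
    -(σ * (Real.sin φ * Real.cos φ) * (Real.cos θ - σ)) / axisDist θ φ⟩

theorem exp_eq_poleTransition_mul {σ : ℝ} (hσ : σ = 1 ∨ σ = -1) {θ φ : ℝ}
    (hD : axisDist θ φ ≠ 0) :
    Complex.exp (Complex.I * (σ * φ : ℝ)) = poleTransition σ θ φ * cyclicPhase θ φ := by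
  have h1 := Real.sin_sq_add_cos_sq φ
  have h2 := axisDist_sq θ φ
  have hexp : Complex.exp (Complex.I * (σ * φ : ℝ)) = ⟨Real.cos φ, σ * Real.sin φ⟩ := by
    rw [mul_comm]
    rcases hσ with rfl | rfl <;> apply Complex.ext <;>
      simp only [Complex.exp_ofReal_mul_I_re, Complex.exp_ofReal_mul_I_im] <;> simp
  have hσ2 : σ ^ 2 = 1 := by rcases hσ with rfl | rfl <;> norm_num
  rw [hexp]
  apply Complex.ext
  · simp only [poleTransition, cyclicPhase, Complex.mul_re]
    field_simp
    linear_combination Real.cos φ * h2 + Real.cos θ * Real.cos φ * σ * h1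
      - Real.sin φ ^ 2 * Real.cos φ * hσ2
  · simp only [poleTransition, cyclicPhase, Complex.mul_im]
    field_simp
    linear_combination σ * Real.sin φ * h2 + σ * Real.sin φ * h1
      + Real.sin φ * Real.cos φ ^ 2 * Real.cos θ * hσ2

theorem eventually_forall_norm_sub_lt {β : Type*} {l : Filter ℝ} {g : ℝ × β → ℂ} {L : ℂ}
    (h : Tendsto g (l ×ˢ ⊤) (𝓝 L)) {ε : ℝ} (hε : 0 < ε) :
    ∀ᶠ θ in l, ∀ φ, ‖g (θ, φ) - L‖ < ε := by
  obtain ⟨p, hp, q, hq, hpq⟩ := eventually_prod_iff.mp (Metric.tendsto_nhds.mp h ε hε)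
  filter_upwards [hp] with θ hθ φ
  simpa [dist_eq_norm] using hpq hθ (eventually_top.mp hq φ)

theorem tendsto_mul_bounded {α : Type*} {l : Filter α} {g h : α → ℝ}
    (hg : Tendsto g l (𝓝 0)) (hh : ∀ a, |h a| ≤ 1) : Tendsto (fun a => h a * g a) l (𝓝 0) := by
  refine squeeze_zero_norm (fun a => ?_) (by simpa using hg.norm)
  rw [norm_mul]
  exact mul_le_of_le_one_left (norm_nonneg _) (hh a)

/-- Near the pole `(0, 0, σ)`, the rotated component `e^{iσsφ} f_I` has a limit along every filter
that drives the colatitude to that pole, whatever the longitude does. -/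
theorem tendsto_exp_mul_spin {s : ℤ} {f : Matrix (Fin 3) (Fin 3) ℝ → (Fin 3 → ℝ) → ℂ}
    (hcont : ContinuousOn (f cyclicRot) (chartU cyclicRot)) (hspin : IsSpinFamily s f)
    {σ : ℝ} (hσ : σ = 1 ∨ σ = -1) {l : Filter (ℝ × ℝ)}
    (hcos : Tendsto (fun a : ℝ × ℝ => Real.cos a.1) l (𝓝 σ))
    (hsin : Tendsto (fun a : ℝ × ℝ => Real.sin a.1) l (𝓝 0))
    (hpos : ∀ᶠ a in l, 0 < Real.sin a.1) :
    Tendsto (fun a : ℝ × ℝ => Complex.exp (Complex.I * (σ * a.2 : ℝ)) ^ s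
      * f 1 (sphCoords a.1 a.2)) l (𝓝 ((-σ : ℂ) ^ s * f cyclicRot ![0, 0, σ])) := by
  have hσ2 : σ ^ 2 = 1 := by rcases hσ with rfl | rfl <;> norm_num
  have hσ0 : σ ≠ 0 := by rcases hσ with rfl | rfl <;> norm_num
  have hx : Tendsto (fun a : ℝ × ℝ => Real.sin a.1 * Real.cos a.2) l (𝓝 0) := by
    simpa only [mul_comm] using tendsto_mul_bounded (h := fun a : ℝ × ℝ => Real.cos a.2) hsin
      fun a => Real.abs_cos_le_one _
  have hy : Tendsto (fun a : ℝ × ℝ => Real.sin a.1 * Real.sin a.2) l (𝓝 0) := by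
    simpa only [mul_comm] using tendsto_mul_bounded (h := fun a : ℝ × ℝ => Real.sin a.2) hsin
      fun a => Real.abs_sin_le_one _
  have hD : Tendsto (fun a : ℝ × ℝ => axisDist a.1 a.2) l (𝓝 1) := by
    have := ((hy.pow 2).add (hcos.pow 2)).sqrt
    simpa only [axisDist, hσ2, ne_eq, OfNat.ofNat_ne_zero, not_false_eq_true, zero_pow, zero_add,
      Real.sqrt_one] using this
  have hcos0 : Tendsto (fun a : ℝ × ℝ => Real.cos a.1 - σ) l (𝓝 0) := by
    simpa using hcos.sub_const σ
  have hre : Tendsto (fun a : ℝ × ℝ => (Real.cos a.1 - σ) * Real.cos a.2 ^ 2) l (𝓝 0) := by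
    simpa only [mul_comm] using
      tendsto_mul_bounded (h := fun a : ℝ × ℝ => Real.cos a.2 ^ 2) hcos0 fun a => by
        rw [abs_of_nonneg (sq_nonneg _)]
        exact Real.cos_sq_le_one _
  have him : Tendsto (fun a : ℝ × ℝ => σ * (Real.sin a.2 * Real.cos a.2) * (Real.cos a.1 - σ)) l
      (𝓝 0) := by
    refine tendsto_mul_bounded hcos0 fun a => ?_
    have hs : |σ| = 1 := by rcases hσ with rfl | rfl <;> norm_num
    rw [abs_mul, abs_mul, hs, one_mul]
    exact mul_le_one₀ (Real.abs_sin_le_one _) (abs_nonneg _) (Real.abs_cos_le_one _)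
  have hw : Tendsto (fun a : ℝ × ℝ => poleTransition σ a.1 a.2) l (𝓝 (-σ : ℂ)) := by
    have hre' := (hre.const_add σ).neg.div hD one_ne_zero
    have him' := him.neg.div hD one_ne_zero
    have := (Complex.equivRealProdCLM.symm.continuous.tendsto _).comp (hre'.prodMk_nhds him')
    convert this using 2
    · apply Complex.ext <;> simp [poleTransition]
    · apply Complex.ext <;> simp
  have hp : Tendsto (fun a : ℝ × ℝ => sphCoords a.1 a.2) l (𝓝 ![0, 0, σ]) := by
    rw [tendsto_pi_nhds]
    intro i
    fin_cases i
    · simpa [sphCoords] using hx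
    · simpa [sphCoords] using hy
    · simpa [sphCoords] using hcos
  have hsin1 : ∀ᶠ a in l, Real.sin a.1 < 1 := hsin.eventually_lt_const one_pos
  have hmem : ∀ᶠ a in l, sphCoords a.1 a.2 ∈ chartU cyclicRot := by
    filter_upwards [hx.abs.eventually_lt_const (by simp : |(0 : ℝ)| < 1)] with a ha
    exact mem_chartU_cyclicRot (dot3_sphCoords _ _) (by simpa [sphCoords] using ha)
  have hpole : (![0, 0, σ] : Fin 3 → ℝ) ∈ chartU cyclicRot :=
    mem_chartU_cyclicRot (by simp [dot3, ← sq, hσ2]) (by simp)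
  have hf := (hcont _ hpole).tendsto.comp (tendsto_nhdsWithin_iff.mpr ⟨hp, hmem⟩)
  refine ((hw.zpow₀ s (Or.inl (by simpa using hσ0))).mul hf).congr' ?_
  filter_upwards [hpos, hsin1, hD.eventually_ne one_ne_zero] with a h0 h1 hne
  rw [exp_eq_poleTransition_mul hσ hne, mul_zpow, mul_assoc, ← spin_cyclicRot_eq hspin h0 h1 hne]
  rfl

/-- **Continuous spin-`s` functions have uniform, `φ`-independent limits at the poles**
(Statement 0). -/
theorem spin_limit_at_poles (s : ℤ) (f : Matrix (Fin 3) (Fin 3) ℝ → (Fin 3 → ℝ) → ℂ)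
    (hcont : ∀ R ∈ SO3set, ContinuousOn (f R) (chartU R))
    (hspin : IsSpinFamily s f) :
    (∃ L : ℂ, ∀ ε : ℝ, 0 < ε → ∃ δ : ℝ, 0 < δ ∧ ∀ θ φ : ℝ, 0 < θ → θ < δ →
      ‖Complex.exp (Complex.I * (s : ℂ) * (φ : ℂ)) * f 1 (sphCoords θ φ) - L‖ < ε) ∧
    (∃ L : ℂ, ∀ ε : ℝ, 0 < ε → ∃ δ : ℝ, 0 < δ ∧ ∀ θ φ : ℝ, Real.pi - δ < θ → θ < Real.pi →
      ‖Complex.exp (-(Complex.I * (s : ℂ) * (φ : ℂ))) * f 1 (sphCoords θ φ) - L‖ < ε) := by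
  have hR := hcont cyclicRot cyclicRot_mem_SO3set
  constructor
  · refine ⟨(-((1 : ℝ) : ℂ)) ^ s * f cyclicRot ![0, 0, 1], fun ε hε => ?_⟩
    have hlim := tendsto_exp_mul_spin (σ := 1) (l := 𝓝[>] 0 ×ˢ ⊤) hR hspin (Or.inl rfl)
      (((Real.continuous_cos.tendsto' 0 1 Real.cos_zero).mono_left nhdsWithin_le_nhds).comp
        tendsto_fst)
      (((Real.continuous_sin.tendsto' 0 0 Real.sin_zero).mono_left nhdsWithin_le_nhds).comp
        tendsto_fst)
      (tendsto_fst.eventually (by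
        filter_upwards [Ioo_mem_nhdsGT Real.pi_pos] with θ hθ
        exact Real.sin_pos_of_mem_Ioo hθ))
    obtain ⟨δ, hδ, h⟩ := mem_nhdsGT_iff_exists_Ioo_subset.mp (eventually_forall_norm_sub_lt hlim hε)
    refine ⟨δ, hδ, fun θ φ h0 h1 => ?_⟩
    have := h ⟨h0, h1⟩ φ
    rw [← Complex.exp_int_mul] at this
    convert this using 5
    push_cast
    ring
  · refine ⟨(-((-1 : ℝ) : ℂ)) ^ s * f cyclicRot ![0, 0, -1], fun ε hε => ?_⟩
    have hlim := tendsto_exp_mul_spin (σ := -1) (l := 𝓝[<] Real.pi ×ˢ ⊤) hR hspin (Or.inr rfl)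
      (((Real.continuous_cos.tendsto' Real.pi (-1) Real.cos_pi).mono_left
        nhdsWithin_le_nhds).comp tendsto_fst)
      (((Real.continuous_sin.tendsto' Real.pi 0 Real.sin_pi).mono_left
        nhdsWithin_le_nhds).comp tendsto_fst)
      (tendsto_fst.eventually (by
        filter_upwards [Ioo_mem_nhdsLT Real.pi_pos] with θ hθ
        exact Real.sin_pos_of_mem_Ioo hθ))
    obtain ⟨c, hc, h⟩ := mem_nhdsLT_iff_exists_Ioo_subset.mp (eventually_forall_norm_sub_lt hlim hε)
    refine ⟨Real.pi - c, sub_pos.mpr hc, fun θ φ h0 h1 => ?_⟩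
    have := h ⟨by linarith, h1⟩ φ
    rw [← Complex.exp_int_mul] at this
    convert this using 5
    push_cast
    ring
end
end

section
/- Let s and l be integers with l ≥ |s| and l ≥ |s+1|, and let −l ≤ m ≤ l. Then on (0,π)×ℝ, ð_s(ₛY_{lm}) = √((l−s)(l+s+1)) · ₛ₊₁Y_{lm}; if l = s (so s ≥ 0), then ð_s(ₛY_{lm}) = 0. Likewise, if l ≥ |s| and l ≥ |s−1|, then ð̄_s(ₛY_{lm}) = −√((l+s)(l−s+1)) · ₛ₋₁Y_{lm}; if l = −s (so s ≤ 0), then ð̄_s(ₛY_{lm}) = 0. -/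
noncomputable section

/-- Integer binomial coefficient, zero outside `0 ≤ j ≤ n`. -/
def izbinom (n j : ℤ) : ℕ := if 0 ≤ j ∧ j ≤ n then n.toNat.choose j.toNat else 0

/-- The normalization constant `a_{lm} = √((l+m)!(l−m)!(2l+1)/(4π))`. -/
noncomputable def alm (l m : ℤ) : ℝ :=
  Real.sqrt ((((l + m).toNat.factorial : ℝ) * ((l - m).toNat.factorial : ℝ) * (2 * (l : ℝ) + 1)) /
    (4 * Real.pi))

/-- The spin-`s` spherical harmonic `ₛY_{lm}` in the standard chart, as a function of `(θ, φ)`. -/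
noncomputable def sY (s l m : ℤ) (x : ℝ × ℝ) : ℂ :=
  Complex.exp (Complex.I * (m : ℂ) * (x.2 : ℂ)) * (-1 : ℂ) ^ (max (-m) 0) *
    ((alm l m / Real.sqrt (((l + s).toNat.factorial : ℝ) * ((l - s).toNat.factorial : ℝ)) : ℝ) : ℂ) *
    ((Real.sin (x.1 / 2) : ℂ)) ^ (2 * l) *
    ∑ r ∈ Finset.Icc (0 : ℤ) (l - s),
      (izbinom (l - s) r : ℂ) * (izbinom (l + s) (r + s - m) : ℂ) * (-1 : ℂ) ^ (l - r - s) *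
        ((Real.cos (x.1 / 2) / Real.sin (x.1 / 2) : ℝ) : ℂ) ^ (2 * r + s - m)
/-- Partial derivative in the first variable. -/
noncomputable def pdθ (h : ℝ × ℝ → ℂ) : ℝ × ℝ → ℂ := fun x => deriv (fun t => h (t, x.2)) x.1

/-- Partial derivative in the second variable. -/
noncomputable def pdφ (h : ℝ × ℝ → ℂ) : ℝ × ℝ → ℂ := fun x => deriv (fun t => h (x.1, t)) x.2
/-- The spin-raising operator `ð_s` in the standard chart. -/
noncomputable def eth (s : ℤ) (h : ℝ × ℝ → ℂ) : ℝ × ℝ → ℂ := fun x =>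
  -((Real.sin x.1 : ℂ) ^ s) *
    (pdθ (fun y => (Real.sin y.1 : ℂ) ^ (-s) * h y) x +
      Complex.I / (Real.sin x.1 : ℂ) * pdφ (fun y => (Real.sin y.1 : ℂ) ^ (-s) * h y) x)

/-- The spin-lowering operator `ð̄_s` in the standard chart. -/
noncomputable def ethbar (s : ℤ) (h : ℝ × ℝ → ℂ) : ℝ × ℝ → ℂ := fun x =>
  -((Real.sin x.1 : ℂ) ^ (-s)) *
    (pdθ (fun y => (Real.sin y.1 : ℂ) ^ s * h y) x -
      Complex.I / (Real.sin x.1 : ℂ) * pdφ (fun y => (Real.sin y.1 : ℂ) ^ s * h y) x)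

theorem izbinom_of_neg {n j : ℤ} (h : j < 0) : izbinom n j = 0 := by
  simp [izbinom, h.not_ge]

theorem izbinom_of_lt {n j : ℤ} (h : n < j) : izbinom n j = 0 := by
  simp [izbinom, h.not_ge]

theorem izbinom_natCast (n j : ℕ) : izbinom n j = n.choose j := by
  by_cases h : j ≤ n
  · simp [izbinom, h]
  · rw [izbinom_of_lt (by omega), Nat.choose_eq_zero_of_lt (by omega)]

/-- Pascal's rule. -/
theorem izbinom_add_one {n : ℤ} (hn : 0 ≤ n) (j : ℤ) :
    izbinom (n + 1) j = izbinom n (j - 1) + izbinom n j := by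
  lift n to ℕ using hn
  rcases lt_trichotomy j 0 with h | rfl | h
  · simp [izbinom_of_neg h, izbinom_of_neg (show j - 1 < 0 by omega)]
  · rw [izbinom_of_neg (show (0 : ℤ) - 1 < 0 by omega)]
    have h1 := izbinom_natCast (n + 1) 0
    have h2 := izbinom_natCast n 0
    push_cast at h1 h2
    simp [h1, h2]
  · obtain ⟨k, rfl⟩ : ∃ k : ℕ, j = k + 1 := ⟨(j - 1).toNat, by omega⟩
    have h1 := izbinom_natCast (n + 1) (k + 1)
    have h2 := izbinom_natCast n (k + 1)
    push_cast at h1 h2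
    rw [h1, h2, add_sub_cancel_right, izbinom_natCast, Nat.choose_succ_succ]

theorem mul_izbinom_add_one {n : ℤ} (hn : 0 ≤ n) (j : ℤ) :
    j * (izbinom (n + 1) j : ℤ) = (n + 1) * izbinom n (j - 1) := by
  lift n to ℕ using hn
  rcases lt_trichotomy j 0 with h | rfl | h
  · simp [izbinom_of_neg h, izbinom_of_neg (show j - 1 < 0 by omega)]
  · rw [izbinom_of_neg (show (0 : ℤ) - 1 < 0 by omega)]
    simp
  · obtain ⟨k, rfl⟩ : ∃ k : ℕ, j = k + 1 := ⟨(j - 1).toNat, by omega⟩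
    have h1 := izbinom_natCast (n + 1) (k + 1)
    push_cast at h1
    rw [h1, add_sub_cancel_right, izbinom_natCast]
    have := Nat.add_one_mul_choose_eq n k
    zify at this
    linarith

theorem sub_mul_izbinom_add_one {n : ℤ} (hn : 0 ≤ n) (j : ℤ) :
    (n + 1 - j) * (izbinom (n + 1) j : ℤ) = (n + 1) * izbinom n j := by
  have h1 := mul_izbinom_add_one hn j
  have h2 := izbinom_add_one hn j
  zify at h2
  linear_combination (n + 1) * h2 - h1

/-- The factor in front of the sum defining `sY`. -/
def sYPrefactor (s l m : ℤ) (x : ℝ × ℝ) : ℂ :=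
  Complex.exp (Complex.I * (m : ℂ) * (x.2 : ℂ)) * (-1 : ℂ) ^ (max (-m) 0) *
    ((alm l m / Real.sqrt (((l + s).toNat.factorial : ℝ) * ((l - s).toNat.factorial : ℝ)) : ℝ) : ℂ) *
    ((Real.sin (x.1 / 2) : ℂ)) ^ (2 * l)

/-- The coefficient of `cot ^ (2 * r + s - m) (θ / 2)` in the sum defining `sY`. -/
def sYCoeff (s l m r : ℤ) : ℂ :=
  (izbinom (l - s) r : ℂ) * (izbinom (l + s) (r + s - m) : ℂ) * (-1 : ℂ) ^ (l - r - s)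

/-- The half-angle cotangent `cot (θ / 2)`. -/
def cotHalf (θ : ℝ) : ℂ := ((Real.cos (θ / 2) / Real.sin (θ / 2) : ℝ) : ℂ)

theorem sY_eq (s l m : ℤ) (x : ℝ × ℝ) :
    sY s l m x = sYPrefactor s l m x *
      ∑ r ∈ Finset.Icc (0 : ℤ) (l - s), sYCoeff s l m r * cotHalf x.1 ^ (2 * r + s - m) := rfl

/-- Powers in terms of the logarithmic derivative. -/
theorem HasDerivAt.zpow_logDeriv {f : ℝ → ℂ} {g : ℂ} {x : ℝ} (hf : HasDerivAt f (f x * g) x)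
    (h0 : f x ≠ 0) (n : ℤ) : HasDerivAt (fun t => f t ^ n) (f x ^ n * (n * g)) x := by
  refine ((hasDerivAt_zpow n (f x) (Or.inl h0)).comp x hf).congr_deriv ?_
  rw [zpow_sub_one₀ h0]
  field_simp

theorem sin_half_pos {θ : ℝ} (hθ : θ ∈ Set.Ioo 0 Real.pi) : 0 < Real.sin (θ / 2) :=
  Real.sin_pos_of_pos_of_lt_pi (by linarith [hθ.1]) (by linarith [hθ.1, hθ.2])

theorem cos_half_pos {θ : ℝ} (hθ : θ ∈ Set.Ioo 0 Real.pi) : 0 < Real.cos (θ / 2) :=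
  Real.cos_pos_of_mem_Ioo ⟨by linarith [hθ.1, Real.pi_pos], by linarith [hθ.2]⟩

theorem cotHalf_ne_zero {θ : ℝ} (hθ : θ ∈ Set.Ioo 0 Real.pi) : cotHalf θ ≠ 0 :=
  Complex.ofReal_ne_zero.2 (div_pos (cos_half_pos hθ) (sin_half_pos hθ)).ne'

theorem sin_eq_half (θ : ℝ) :
    Real.sin θ = 2 * Real.sin (θ / 2) * Real.cos (θ / 2) := by
  rw [← Real.sin_two_mul]; ring_nf

theorem cos_eq_half (θ : ℝ) :
    Real.cos θ = Real.cos (θ / 2) ^ 2 - Real.sin (θ / 2) ^ 2 := by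
  rw [← Real.cos_two_mul']; ring_nf

theorem hasDerivAt_sin_half (θ : ℝ) :
    HasDerivAt (fun t : ℝ => Real.sin (t / 2)) (Real.cos (θ / 2) / 2) θ := by
  convert ((hasDerivAt_id' θ).div_const 2).sin using 1
  simp; ring

theorem hasDerivAt_cos_half (θ : ℝ) :
    HasDerivAt (fun t : ℝ => Real.cos (t / 2)) (-Real.sin (θ / 2) / 2) θ := by
  convert ((hasDerivAt_id' θ).div_const 2).cos using 1
  simp; ring

theorem hasDerivAt_cotHalf {θ : ℝ} (hθ : θ ∈ Set.Ioo 0 Real.pi) :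
    HasDerivAt cotHalf (cotHalf θ * ((-1 / Real.sin θ : ℝ) : ℂ)) θ := by
  have hs := (sin_half_pos hθ).ne'
  have hc := (cos_half_pos hθ).ne'
  have h := ((hasDerivAt_cos_half θ).div (hasDerivAt_sin_half θ) hs).ofReal_comp
  refine h.congr_deriv ?_
  rw [cotHalf, ← Complex.ofReal_mul, sin_eq_half θ]
  congr 1
  field_simp
  linear_combination -Real.sin_sq_add_cos_sq (θ / 2)

/-- The `θ`-derivative of `sin ^ w θ * sY`. -/
theorem hasDerivAt_sin_zpow_mul_sY (w s l m : ℤ) {θ : ℝ} (φ : ℝ) (hθ : θ ∈ Set.Ioo 0 Real.pi) :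
    HasDerivAt (fun t : ℝ => (Real.sin t : ℂ) ^ w * sY s l m (t, φ))
      ((Real.sin θ : ℂ) ^ w * (sYPrefactor s l m (θ, φ) *
        ∑ r ∈ Finset.Icc (0 : ℤ) (l - s), sYCoeff s l m r * cotHalf θ ^ (2 * r + s - m) *
          (w * ((Real.cos θ / Real.sin θ : ℝ) : ℂ) + l * cotHalf θ
            - (2 * r + s - m) * ((1 / Real.sin θ : ℝ) : ℂ)))) θ := by
  have hs := (sin_half_pos hθ).ne'
  have hsin : Real.sin θ ≠ 0 := (Real.sin_pos_of_mem_Ioo hθ).ne'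
  have h1 : HasDerivAt (fun t : ℝ => (Real.sin t : ℂ) ^ w) _ θ :=
    HasDerivAt.zpow_logDeriv (g := ((Real.cos θ / Real.sin θ : ℝ) : ℂ))
      ((Real.hasDerivAt_sin θ).ofReal_comp.congr_deriv
        (by rw [← Complex.ofReal_mul, mul_div_cancel₀ _ hsin])) (Complex.ofReal_ne_zero.2 hsin) w
  have h2 : HasDerivAt (fun t : ℝ => (Real.sin (t / 2) : ℂ) ^ (2 * l)) _ θ :=
    HasDerivAt.zpow_logDeriv (g := ((Real.cos (θ / 2) / Real.sin (θ / 2) / 2 : ℝ) : ℂ))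
      ((hasDerivAt_sin_half θ).ofReal_comp.congr_deriv
        (by rw [← Complex.ofReal_mul]; congr 1; field_simp)) (Complex.ofReal_ne_zero.2 hs) (2 * l)
  have h3 := HasDerivAt.fun_sum (u := Finset.Icc (0 : ℤ) (l - s)) fun r _ =>
    ((hasDerivAt_cotHalf hθ).zpow_logDeriv (cotHalf_ne_zero hθ) (2 * r + s - m)).const_mul
      (sYCoeff s l m r)
  have h4 := h1.mul ((h2.const_mul (Complex.exp (Complex.I * (m : ℂ) * (φ : ℂ)) *
    (-1 : ℂ) ^ (max (-m) 0) * ((alm l m / Real.sqrt (((l + s).toNat.factorial : ℝ) *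
      ((l - s).toNat.factorial : ℝ)) : ℝ) : ℂ))).mul h3)
  refine h4.congr_deriv ?_
  have hsum : ∑ r ∈ Finset.Icc (0 : ℤ) (l - s), sYCoeff s l m r * cotHalf θ ^ (2 * r + s - m) *
        (w * ((Real.cos θ / Real.sin θ : ℝ) : ℂ) + l * cotHalf θ
          - (2 * r + s - m) * ((1 / Real.sin θ : ℝ) : ℂ)) =
      (w * ((Real.cos θ / Real.sin θ : ℝ) : ℂ) + l * cotHalf θ) *
        ∑ r ∈ Finset.Icc (0 : ℤ) (l - s), sYCoeff s l m r * cotHalf θ ^ (2 * r + s - m) +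
      ∑ r ∈ Finset.Icc (0 : ℤ) (l - s), sYCoeff s l m r * (cotHalf θ ^ (2 * r + s - m) *
        (((2 * r + s - m : ℤ) : ℂ) * ((-1 / Real.sin θ : ℝ) : ℂ))) := by
    rw [Finset.mul_sum, ← Finset.sum_add_distrib]
    refine Finset.sum_congr rfl fun r _ => ?_
    push_cast
    ring
  have hhalf : ((Real.cos (θ / 2) / Real.sin (θ / 2) / 2 : ℝ) : ℂ) = cotHalf θ / 2 := by
    rw [cotHalf]; push_cast; rfl
  rw [hsum, hhalf, sYPrefactor]
  generalize (∑ r ∈ Finset.Icc (0 : ℤ) (l - s), sYCoeff s l m r * (cotHalf θ ^ (2 * r + s - m) *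
    (((2 * r + s - m : ℤ) : ℂ) * ((-1 / Real.sin θ : ℝ) : ℂ)))) = B'
  simp only [Pi.mul_apply]
  push_cast
  ring

theorem hasDerivAt_sY_snd (s l m : ℤ) (θ φ : ℝ) :
    HasDerivAt (fun t : ℝ => sY s l m (θ, t)) (Complex.I * m * sY s l m (θ, φ)) φ := by
  have h : HasDerivAt (fun t : ℝ => Complex.exp (Complex.I * (m : ℂ) * (t : ℂ)))
      (Complex.I * m * Complex.exp (Complex.I * (m : ℂ) * (φ : ℂ))) φ := by
    convert (((hasDerivAt_id' φ).ofReal_comp).const_mul (Complex.I * (m : ℂ))).cexp using 1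
    simp [mul_comm]
  simp only [sY]
  refine ((((h.mul_const _).mul_const _).mul_const _).mul_const _).congr_deriv ?_
  ring

theorem eth_sY_eq_sum (s l m : ℤ) {θ : ℝ} (φ : ℝ) (hθ : θ ∈ Set.Ioo 0 Real.pi) :
    eth s (sY s l m) (θ, φ) = sYPrefactor s l m (θ, φ) *
      ∑ r ∈ Finset.Icc (0 : ℤ) (l - s), sYCoeff s l m r *
        (r * cotHalf θ ^ (2 * r + s - m - 1) - (l - s - r) * cotHalf θ ^ (2 * r + s - m + 1)) := by
  have hu := cotHalf_ne_zero hθ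
  have hs := Complex.ofReal_ne_zero.2 (sin_half_pos hθ).ne'
  have hc := Complex.ofReal_ne_zero.2 (cos_half_pos hθ).ne'
  have hsin : (Real.sin θ : ℂ) ≠ 0 :=
    Complex.ofReal_ne_zero.2 (Real.sin_pos_of_mem_Ioo hθ).ne'
  have hw := zpow_ne_zero s hsin
  simp only [eth, pdθ, pdφ]
  rw [(hasDerivAt_sin_zpow_mul_sY (-s) s l m φ hθ).deriv,
    ((hasDerivAt_sY_snd s l m θ φ).const_mul _).deriv, sY_eq]
  have key : ∀ r : ℤ, sYCoeff s l m r *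
        (r * cotHalf θ ^ (2 * r + s - m - 1) - (l - s - r) * cotHalf θ ^ (2 * r + s - m + 1)) =
      -(sYCoeff s l m r * cotHalf θ ^ (2 * r + s - m) *
          ((-s : ℤ) * ((Real.cos θ / Real.sin θ : ℝ) : ℂ) + l * cotHalf θ
            - (2 * r + s - m) * ((1 / Real.sin θ : ℝ) : ℂ)))
        + m / Real.sin θ * (sYCoeff s l m r * cotHalf θ ^ (2 * r + s - m)) := by
    intro r
    rw [zpow_sub_one₀ hu, zpow_add_one₀ hu]
    generalize cotHalf θ ^ (2 * r + s - m) = U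
    rw [sin_eq_half θ, cos_eq_half θ, cotHalf]
    have hp : (Real.sin (θ / 2) : ℂ) ^ 2 + (Real.cos (θ / 2) : ℂ) ^ 2 = 1 := by
      exact_mod_cast Real.sin_sq_add_cos_sq (θ / 2)
    push_cast at *
    generalize Complex.sin (θ / 2) = S at *
    generalize Complex.cos (θ / 2) = C at *
    field_simp
    linear_combination sYCoeff s l m r * U * (2 * r + s) * hp
  simp only [key, Finset.sum_add_distrib, Finset.sum_neg_distrib, ← Finset.mul_sum]
  generalize (∑ r ∈ Finset.Icc (0 : ℤ) (l - s),
    sYCoeff s l m r * cotHalf θ ^ (2 * r + s - m)) = B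
  generalize Finset.sum (M := ℂ) _ _ = A
  rw [zpow_neg]
  field_simp
  rw [Complex.I_sq]
  ring

theorem ethbar_sY_eq_sum (s l m : ℤ) {θ : ℝ} (φ : ℝ) (hθ : θ ∈ Set.Ioo 0 Real.pi) :
    ethbar s (sY s l m) (θ, φ) = sYPrefactor s l m (θ, φ) *
      ∑ r ∈ Finset.Icc (0 : ℤ) (l - s), sYCoeff s l m r *
        ((r + s - m) * cotHalf θ ^ (2 * r + s - m - 1)
          - (l - r + m) * cotHalf θ ^ (2 * r + s - m + 1)) := by
  have hu := cotHalf_ne_zero hθ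
  have hs := Complex.ofReal_ne_zero.2 (sin_half_pos hθ).ne'
  have hc := Complex.ofReal_ne_zero.2 (cos_half_pos hθ).ne'
  have hsin : (Real.sin θ : ℂ) ≠ 0 :=
    Complex.ofReal_ne_zero.2 (Real.sin_pos_of_mem_Ioo hθ).ne'
  have hw := zpow_ne_zero s hsin
  simp only [ethbar, pdθ, pdφ]
  rw [(hasDerivAt_sin_zpow_mul_sY s s l m φ hθ).deriv,
    ((hasDerivAt_sY_snd s l m θ φ).const_mul _).deriv, sY_eq]
  have key : ∀ r : ℤ, sYCoeff s l m r *
        ((r + s - m) * cotHalf θ ^ (2 * r + s - m - 1)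
          - (l - r + m) * cotHalf θ ^ (2 * r + s - m + 1)) =
      -(sYCoeff s l m r * cotHalf θ ^ (2 * r + s - m) *
          (s * ((Real.cos θ / Real.sin θ : ℝ) : ℂ) + l * cotHalf θ
            - (2 * r + s - m) * ((1 / Real.sin θ : ℝ) : ℂ)))
        - m / Real.sin θ * (sYCoeff s l m r * cotHalf θ ^ (2 * r + s - m)) := by
    intro r
    rw [zpow_sub_one₀ hu, zpow_add_one₀ hu]
    generalize cotHalf θ ^ (2 * r + s - m) = U
    rw [sin_eq_half θ, cos_eq_half θ, cotHalf]
    have hp : (Real.sin (θ / 2) : ℂ) ^ 2 + (Real.cos (θ / 2) : ℂ) ^ 2 = 1 := by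
      exact_mod_cast Real.sin_sq_add_cos_sq (θ / 2)
    push_cast at *
    generalize Complex.sin (θ / 2) = S at *
    generalize Complex.cos (θ / 2) = C at *
    field_simp
    linear_combination sYCoeff s l m r * U * (2 * r + s - 2 * m) * hp
  simp only [key, Finset.sum_sub_distrib, Finset.sum_neg_distrib, ← Finset.mul_sum]
  generalize (∑ r ∈ Finset.Icc (0 : ℤ) (l - s),
    sYCoeff s l m r * cotHalf θ ^ (2 * r + s - m)) = B
  generalize Finset.sum (M := ℂ) _ _ = A
  rw [zpow_neg]
  field_simp
  rw [Complex.I_sq]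
  ring

theorem sum_Icc_add_one (F : ℤ → ℂ) (a b : ℤ) :
    ∑ r ∈ Finset.Icc a b, F (r + 1) = ∑ r ∈ Finset.Icc (a + 1) (b + 1), F r := by
  refine Finset.sum_nbij' (· + 1) (· - 1) ?_ ?_ ?_ ?_ ?_ <;> simp

theorem sum_Icc_succ_bot_of_eq_zero {F : ℤ → ℂ} {a : ℤ} (h : F a = 0) (b : ℤ) :
    ∑ r ∈ Finset.Icc (a + 1) b, F r = ∑ r ∈ Finset.Icc a b, F r := by
  refine Finset.sum_subset (Finset.Icc_subset_Icc_left (by omega)) fun r h1 h2 => ?_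
  rw [Finset.mem_Icc] at h1 h2
  rwa [show r = a by omega]

theorem sum_Icc_pred_top_of_eq_zero {F : ℤ → ℂ} {b : ℤ} (h : F b = 0) (a : ℤ) :
    ∑ r ∈ Finset.Icc a (b - 1), F r = ∑ r ∈ Finset.Icc a b, F r := by
  refine Finset.sum_subset (Finset.Icc_subset_Icc_right (by omega)) fun r h1 h2 => ?_
  rw [Finset.mem_Icc] at h1 h2
  rwa [show r = b by omega]

theorem sYCoeff_raise {s l : ℤ} (h1 : s + 1 ≤ l) (h2 : -l ≤ s) (m r : ℤ) :
    (r + 1) * sYCoeff s l m (r + 1) - (l - s - r) * sYCoeff s l m r =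
      (l - s) * sYCoeff (s + 1) l m r := by
  have e1 := mul_izbinom_add_one (show 0 ≤ l - s - 1 by omega) (r + 1)
  have e2 := sub_mul_izbinom_add_one (show 0 ≤ l - s - 1 by omega) r
  have e3 := izbinom_add_one (show 0 ≤ l + s by omega) (r + (s + 1) - m)
  have e4 : (-1 : ℂ) ^ (l - r - s) = (-1) ^ (l - r - (s + 1)) * (-1) := by
    rw [← zpow_add_one₀ (by norm_num)]; ring_nf
  simp only [sub_add_cancel, add_sub_cancel_right] at e1 e2
  simp only [sYCoeff]
  rw [e4, show l - (s + 1) = l - s - 1 by ring, show l + (s + 1) = l + s + 1 by ring, e3,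
    show r + 1 + s - m = r + (s + 1) - m by ring, show l - (r + 1) - s = l - r - (s + 1) by ring,
    show r + s - m = r + (s + 1) - m - 1 by ring]
  have e1' := congrArg (Int.cast : ℤ → ℂ) e1
  have e2' := congrArg (Int.cast : ℤ → ℂ) e2
  push_cast at e1' e2' ⊢
  linear_combination (izbinom (l + s) (r + (s + 1) - m) : ℂ) * (-1) ^ (l - r - (s + 1)) * e1' +
    (izbinom (l + s) (r + (s + 1) - m - 1) : ℂ) * (-1) ^ (l - r - (s + 1)) * e2'

theorem sYCoeff_lower {s l : ℤ} (h1 : s ≤ l) (h2 : -l ≤ s - 1) (m r : ℤ) :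
    (r + s - m) * sYCoeff s l m r - (l - (r - 1) + m) * sYCoeff s l m (r - 1) =
      -((l + s) * sYCoeff (s - 1) l m r) := by
  have e1 := mul_izbinom_add_one (show 0 ≤ l + s - 1 by omega) (r + s - m)
  have e2 := sub_mul_izbinom_add_one (show 0 ≤ l + s - 1 by omega) (r + (s - 1) - m)
  have e3 := izbinom_add_one (show 0 ≤ l - s by omega) r
  have e4 : (-1 : ℂ) ^ (l - r - (s - 1)) = (-1) ^ (l - r - s) * (-1) := by
    rw [← zpow_add_one₀ (by norm_num)]; ring_nf
  have e5 : (-1 : ℂ) ^ (l - (r - 1) - s) = (-1) ^ (l - r - s) * (-1) := by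
    rw [← zpow_add_one₀ (by norm_num)]; ring_nf
  simp only [sub_add_cancel] at e1 e2
  rw [show r + s - m - 1 = r + (s - 1) - m by ring] at e1
  simp only [sYCoeff]
  rw [e4, e5, show l - (s - 1) = l - s + 1 by ring, show l + (s - 1) = l + s - 1 by ring, e3,
    show r - 1 + s - m = r + (s - 1) - m by ring]
  have e1' := congrArg (Int.cast : ℤ → ℂ) e1
  have e2' := congrArg (Int.cast : ℤ → ℂ) e2
  push_cast at e1' e2' ⊢
  linear_combination (izbinom (l - s) r : ℂ) * (-1) ^ (l - r - s) * e1' +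
    (izbinom (l - s) (r - 1) : ℂ) * (-1) ^ (l - r - s) * e2'

theorem succ_div_sqrt_factorial (a k : ℕ) :
    ((k : ℝ) + 1) / Real.sqrt ((a.factorial : ℝ) * ((k + 1).factorial : ℝ)) =
      Real.sqrt (((k : ℝ) + 1) * (a + 1)) /
        Real.sqrt (((a + 1).factorial : ℝ) * (k.factorial : ℝ)) := by
  have ha := Nat.cast_pos (α := ℝ).2 a.factorial_pos
  have hk := Nat.cast_pos (α := ℝ).2 k.factorial_pos
  have ha' := Nat.cast_pos (α := ℝ).2 (a + 1).factorial_pos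
  have hk' := Nat.cast_pos (α := ℝ).2 (k + 1).factorial_pos
  rw [div_eq_div_iff (by positivity) (by positivity), ← Real.sqrt_mul (by positivity),
    Nat.factorial_succ, Nat.factorial_succ]
  push_cast
  rw [show ((k : ℝ) + 1) * (a + 1) * (a.factorial * ((k + 1) * k.factorial)) =
    (k + 1) ^ 2 * ((a + 1) * a.factorial * k.factorial) by ring,
    Real.sqrt_mul (sq_nonneg ((k : ℝ) + 1)), Real.sqrt_sq (by positivity)]

theorem sYPrefactor_raise {s l : ℤ} (h1 : s + 1 ≤ l) (h2 : -l ≤ s) (m : ℤ) (x : ℝ × ℝ) :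
    sYPrefactor s l m x * (l - s) =
      (Real.sqrt (((l - s) * (l + s + 1) : ℤ) : ℝ) : ℂ) * sYPrefactor (s + 1) l m x := by
  obtain ⟨a, ha⟩ : ∃ a : ℕ, l + s = a := ⟨(l + s).toNat, by omega⟩
  obtain ⟨k, hk⟩ : ∃ k : ℕ, l - s = k + 1 := ⟨(l - s - 1).toNat, by omega⟩
  have key := congrArg (Complex.ofReal) (succ_div_sqrt_factorial a k)
  have hk' : (l : ℂ) - s = k + 1 := by exact_mod_cast hk
  simp only [sYPrefactor]
  rw [hk', ha, hk, show l + (s + 1) = (a + 1 : ℕ) by push_cast; omega,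
    show l - (s + 1) = k by omega, show ((k : ℤ) + 1).toNat = k + 1 by omega]
  simp only [Int.toNat_natCast]
  push_cast at key ⊢
  linear_combination Complex.exp (Complex.I * m * x.2) * (-1) ^ (max (-m) 0) * alm l m *
    Complex.sin (x.1 / 2) ^ (2 * l) * key

theorem sYPrefactor_lower {s l : ℤ} (h1 : s ≤ l) (h2 : -l ≤ s - 1) (m : ℤ) (x : ℝ × ℝ) :
    sYPrefactor s l m x * (l + s) =
      (Real.sqrt (((l + s) * (l - s + 1) : ℤ) : ℝ) : ℂ) * sYPrefactor (s - 1) l m x := by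
  obtain ⟨a, ha⟩ : ∃ a : ℕ, l - s = a := ⟨(l - s).toNat, by omega⟩
  obtain ⟨k, hk⟩ : ∃ k : ℕ, l + s = k + 1 := ⟨(l + s - 1).toNat, by omega⟩
  have key := congrArg (Complex.ofReal) (succ_div_sqrt_factorial a k)
  rw [mul_comm (a.factorial : ℝ), mul_comm ((a + 1).factorial : ℝ)] at key
  have hk' : (l : ℂ) + s = k + 1 := by exact_mod_cast hk
  simp only [sYPrefactor]
  rw [hk', ha, hk, show l - (s - 1) = (a + 1 : ℕ) by push_cast; omega,
    show l + (s - 1) = k by omega, show ((k : ℤ) + 1).toNat = k + 1 by omega]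
  simp only [Int.toNat_natCast]
  push_cast at key ⊢
  linear_combination Complex.exp (Complex.I * m * x.2) * (-1) ^ (max (-m) 0) * alm l m *
    Complex.sin (x.1 / 2) ^ (2 * l) * key

theorem sum_sYCoeff_raise {s l : ℤ} (h1 : s + 1 ≤ l) (h2 : -l ≤ s) (m : ℤ) (u : ℂ) :
    ∑ r ∈ Finset.Icc (0 : ℤ) (l - s), sYCoeff s l m r *
        (r * u ^ (2 * r + s - m - 1) - (l - s - r) * u ^ (2 * r + s - m + 1)) =
      (l - s) * ∑ r ∈ Finset.Icc (0 : ℤ) (l - (s + 1)),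
        sYCoeff (s + 1) l m r * u ^ (2 * r + (s + 1) - m) := by
  simp only [mul_sub, Finset.sum_sub_distrib]
  rw [← sum_Icc_succ_bot_of_eq_zero (a := 0) (by simp), show l - s = l - s - 1 + 1 by ring,
    ← sum_Icc_add_one, sub_add_cancel, ← sum_Icc_pred_top_of_eq_zero (b := l - s) (by simp),
    ← Finset.sum_sub_distrib, Finset.mul_sum, show l - (s + 1) = l - s - 1 by ring]
  refine Finset.sum_congr rfl fun r _ => ?_
  rw [← mul_assoc ((l : ℂ) - s), ← sYCoeff_raise h1 h2,
    show 2 * (r + 1) + s - m - 1 = 2 * r + (s + 1) - m by ring,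
    show 2 * r + s - m + 1 = 2 * r + (s + 1) - m by ring]
  push_cast
  ring

theorem sum_sYCoeff_lower {s l : ℤ} (h1 : s ≤ l) (h2 : -l ≤ s - 1) (m : ℤ) (u : ℂ) :
    ∑ r ∈ Finset.Icc (0 : ℤ) (l - s), sYCoeff s l m r *
        ((r + s - m) * u ^ (2 * r + s - m - 1) - (l - r + m) * u ^ (2 * r + s - m + 1)) =
      -((l + s) * ∑ r ∈ Finset.Icc (0 : ℤ) (l - (s - 1)),
        sYCoeff (s - 1) l m r * u ^ (2 * r + (s - 1) - m)) := by
  have hshift := sum_Icc_add_one (fun r => sYCoeff s l m (r - 1) *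
    ((l - (r - 1 : ℤ) + m) * u ^ (2 * (r - 1) + s - m + 1))) 0 (l - s)
  simp only [add_sub_cancel_right] at hshift
  simp only [mul_sub, Finset.sum_sub_distrib]
  rw [hshift, sum_Icc_succ_bot_of_eq_zero (by simp [sYCoeff, izbinom_of_neg]),
    show l - s = l - s + 1 - 1 by ring, sum_Icc_pred_top_of_eq_zero (b := l - s + 1)
      (by simp [sYCoeff, izbinom_of_lt]), sub_add_cancel, ← Finset.sum_sub_distrib,
    Finset.mul_sum, ← Finset.sum_neg_distrib, show l - (s - 1) = l - s + 1 by ring]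
  refine Finset.sum_congr rfl fun r _ => ?_
  rw [← mul_assoc ((l : ℂ) + s), ← neg_mul, ← sYCoeff_lower h1 h2,
    show 2 * (r - 1) + s - m + 1 = 2 * r + (s - 1) - m by ring,
    show 2 * r + s - m - 1 = 2 * r + (s - 1) - m by ring]
  push_cast
  ring

/-- **Spin raising and lowering of the spin spherical harmonics** (Statement 2). -/
theorem eth_sY (s l m : ℤ) (hl : |s| ≤ l) (hm : -l ≤ m) (hm' : m ≤ l) :
    (|s + 1| ≤ l → ∀ θ φ : ℝ, θ ∈ Set.Ioo 0 Real.pi →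
      eth s (sY s l m) (θ, φ) =
        (Real.sqrt (((l - s) * (l + s + 1) : ℤ) : ℝ) : ℂ) * sY (s + 1) l m (θ, φ)) ∧
    (l = s → ∀ θ φ : ℝ, θ ∈ Set.Ioo 0 Real.pi → eth s (sY s l m) (θ, φ) = 0) ∧
    (|s - 1| ≤ l → ∀ θ φ : ℝ, θ ∈ Set.Ioo 0 Real.pi →
      ethbar s (sY s l m) (θ, φ) =
        -(Real.sqrt (((l + s) * (l - s + 1) : ℤ) : ℝ) : ℂ) * sY (s - 1) l m (θ, φ)) ∧
    (l = -s → ∀ θ φ : ℝ, θ ∈ Set.Ioo 0 Real.pi → ethbar s (sY s l m) (θ, φ) = 0) := by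
  obtain ⟨hs, hs'⟩ := abs_le.1 hl
  refine ⟨fun h θ φ hθ => ?_, fun h θ φ hθ => ?_, fun h θ φ hθ => ?_, fun h θ φ hθ => ?_⟩
  · have h1 := (abs_le.1 h).2
    rw [eth_sY_eq_sum s l m φ hθ, sum_sYCoeff_raise h1 hs, ← mul_assoc,
      sYPrefactor_raise h1 hs, sY_eq, mul_assoc]
  · subst h
    simp [eth_sY_eq_sum l l m φ hθ]
  · have h1 := (abs_le.1 h).1
    rw [ethbar_sY_eq_sum s l m φ hθ, sum_sYCoeff_lower hs' h1, mul_neg, ← mul_assoc,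
      sYPrefactor_lower hs' h1, sY_eq, neg_mul, mul_assoc]
  · rw [ethbar_sY_eq_sum s l m φ hθ, Finset.sum_eq_zero, mul_zero]
    intro r _
    rcases eq_or_ne (r + s - m) 0 with h0 | h0
    · have e1 : (r : ℂ) + s - m = 0 := by exact_mod_cast h0
      have e2 : (l : ℂ) - r + m = 0 := by
        have : l - r + m = 0 := by omega
        exact_mod_cast this
      rw [e1, e2]
      simp
    · have : izbinom (l + s) (r + s - m) = 0 := by
        rcases h0.lt_or_gt with h0 | h0
        · exact izbinom_of_neg h0
        · exact izbinom_of_lt (by omega)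
      simp [sYCoeff, this]
end
end

section
/- Let s be an integer. The family of functions {(θ,φ) ↦ ₛY_{lm}(θ,φ) : l ≥ |s|, −l ≤ m ≤ l} is a complete orthonormal system (Hilbert basis) of the Hilbert space L²((0,π)×(−π,π), sin θ dθ dφ) of square-integrable complex-valued functions with respect to the measure sin θ dθ dφ. -/
noncomputable section

open MeasureTheory

/-- The measure `sin θ dθ dφ` on `(0,π) × (−π,π)`. -/
noncomputable def sphMeas : Measure (ℝ × ℝ) :=
  (volume.restrict (Set.Ioo (0 : ℝ) Real.pi ×ˢ Set.Ioo (-Real.pi) Real.pi)).withDensity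
    (fun x => ENNReal.ofReal (Real.sin x.1))

open Polynomial in
lemma sum_neg_one_pow_choose_mul_eval {Q : ℝ[X]} (hQ : Q.Monic) {n : ℕ} (hn : Q.natDegree ≤ n) :
    ∑ i ∈ Finset.range (n + 1), (-1 : ℝ) ^ (n + i) * n.choose i * Q.eval (i : ℝ) =
      if Q.natDegree = n then (n.factorial : ℝ) else 0 := by
  have key : (fwdDiff (1 : ℝ))^[n] Q.eval 0 =
      ∑ i ∈ Finset.range (n + 1), (-1 : ℝ) ^ (n + i) * n.choose i * Q.eval (i : ℝ) := by
    rw [fwdDiff_iter_eq_sum_shift]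
    refine Finset.sum_congr rfl fun i hi => ?_
    have hi' : i ≤ n := by simpa [Nat.lt_succ_iff] using hi
    have : (-1 : ℝ) ^ (n - i) = (-1) ^ (n + i) := by
      obtain ⟨j, rfl⟩ := Nat.exists_eq_add_of_le hi'
      rw [Nat.add_sub_cancel_left, show i + j + i = 2 * i + j by ring, pow_add, pow_mul]
      simp
    simp [zsmul_eq_mul, this]
  rw [← key]
  split_ifs with h
  · subst h
    rw [Polynomial.fwdDiff_iter_degree_eq_factorial, hQ.leadingCoeff]
    simp
  · rw [Polynomial.fwdDiff_iter_eq_zero_of_degree_lt (lt_of_le_of_ne hn h)]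
    rfl

open Polynomial in
lemma sum_antidiagonal_choose_mul_factorial (n N k d i' j' : ℕ) (hi : i' ≤ n) (hj : j' ≤ N)
    (hk : i' + j' = k) :
    ∑ ij ∈ Finset.HasAntidiagonal.antidiagonal (k + d),
      (-1 : ℝ) ^ (n + d + ij.1) * (n + d).choose ij.1 * (N + d).choose ij.2 *
        ((i' + (N + d - ij.2)).factorial * (ij.2 + (n - i')).factorial) =
      if d = 0 then (-1 : ℝ) ^ (n + i') * n.factorial * N.factorial else 0 := by
  set Q : ℝ[X] := (∏ u ∈ Finset.range i', (X + C ((N : ℝ) - k + (u + 1)))) *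
    ∏ u ∈ Finset.range (n - i'), (X - C ((k : ℝ) + d + (u + 1))) with hQdef
  have h1 : (∏ u ∈ Finset.range i', (X + C ((N : ℝ) - k + (u + 1)))).Monic :=
    monic_prod_of_monic _ _ fun u _ => monic_X_add_C _
  have h2 : (∏ u ∈ Finset.range (n - i'), (X - C ((k : ℝ) + d + (u + 1)))).Monic :=
    monic_prod_of_monic _ _ fun u _ => monic_X_sub_C _
  have hQ : Q.Monic := h1.mul h2
  have hdeg : Q.natDegree = n := by
    rw [hQdef, h1.natDegree_mul h2, natDegree_prod_of_monic _ _ fun u _ => monic_X_add_C _,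
      natDegree_prod_of_monic _ _ fun u _ => monic_X_sub_C _]
    simp only [natDegree_X_add_C, natDegree_X_sub_C, Finset.sum_const, Finset.card_range,
      smul_eq_mul, mul_one]
    omega
  have heval : ∀ x : ℝ, (-1 : ℝ) ^ (n + i') * Q.eval x =
      (∏ u ∈ Finset.range i', (x + (N - k + (u + 1)))) *
        ∏ u ∈ Finset.range (n - i'), ((k : ℝ) + d - x + (u + 1)) := by
    intro x
    have : (-1 : ℝ) ^ (n + i') = (-1) ^ (n - i') := by
      obtain ⟨j, rfl⟩ := Nat.exists_eq_add_of_le hi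
      rw [Nat.add_sub_cancel_left, show i' + j + i' = 2 * i' + j by ring, pow_add, pow_mul]
      simp
    rw [hQdef, eval_mul, eval_prod, eval_prod, mul_left_comm, this]
    congr 1
    · simp
    · conv_lhs => rw [← Finset.card_range (n - i'), ← Finset.prod_const]
      rw [Finset.card_range, ← Finset.prod_mul_distrib]
      refine Finset.prod_congr rfl fun u _ => ?_
      simp only [eval_sub, eval_X, eval_C]
      ring
  have hasc : ∀ a b : ℕ, ((a + b).factorial : ℝ) =
      a.factorial * ∏ u ∈ Finset.range b, ((a : ℝ) + (u + 1)) := by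
    intro a b
    rw [← Nat.factorial_mul_ascFactorial, Nat.ascFactorial_eq_prod_range]
    push_cast
    congr 1
    exact Finset.prod_congr rfl fun u _ => by ring
  set g : ℕ → ℝ := fun i => (-1 : ℝ) ^ (n + d + i) * (n + d).choose i * Q.eval (i : ℝ) with hg
  have hterm : ∀ i ≤ k + d, (-1 : ℝ) ^ (n + d + i) * (n + d).choose i *
      (N + d).choose (k + d - i) *
        ((i' + (N + d - (k + d - i))).factorial * (k + d - i + (n - i')).factorial) =
      (-1) ^ (n + i') * (N + d).factorial * g i := by
    intro i hik
    obtain ⟨j, hj'⟩ := Nat.exists_eq_add_of_le hik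
    have e1 : k + d - i = j := by omega
    have ecast : (k : ℝ) + d = i + j := by exact_mod_cast hj'
    rw [e1, hg]
    suffices h : ((N + d).choose j : ℝ) *
        ((i' + (N + d - j)).factorial * (j + (n - i')).factorial) =
        (N + d).factorial * ((-1) ^ (n + i') * Q.eval (i : ℝ)) by
      linear_combination (-1 : ℝ) ^ (n + d + i) * (n + d).choose i * h
    rw [heval]
    by_cases hjN : j ≤ N + d
    · obtain ⟨q, hq⟩ := Nat.exists_eq_add_of_le hjN
      have ecast2 : (N : ℝ) + d = j + q := by exact_mod_cast hq
      have e3 : N + d - j = q := by omega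
      have hch : ((N + d).factorial : ℝ) = (N + d).choose j * j.factorial * q.factorial := by
        rw [← e3]; exact_mod_cast (Nat.choose_mul_factorial_mul_factorial hjN).symm
      rw [e3, add_comm i' q, hasc q i', hasc j (n - i'), hch]
      have a1 : ∀ u : ℝ, (i : ℝ) + (N - k + (u + 1)) = q + (u + 1) := fun u => by linarith
      have a2 : ∀ u : ℝ, (k : ℝ) + d - i + (u + 1) = j + (u + 1) := fun u => by linarith
      simp only [a1, a2]
      ring
    · rw [Nat.choose_eq_zero_of_lt (by omega)]
      rw [Finset.prod_eq_zero (i := k - N - i - 1) (s := Finset.range i')]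
      · simp
      · rw [Finset.mem_range]; omega
      · have : ((k - N - i - 1 : ℕ) : ℝ) + 1 = k - N - i := by
          have : (k - N - i - 1) + 1 + N + i = k := by omega
          have := congrArg (Nat.cast : ℕ → ℝ) this
          push_cast at this
          linarith
        rw [this]; ring
  have hgk : ∀ i, k + d < i → i ≤ n + d → g i = 0 := by
    intro i h1 h2
    have : (-1 : ℝ) ^ (n + i') * Q.eval (i : ℝ) = 0 := by
      rw [heval]
      rw [Finset.prod_eq_zero (i := i - (k + d) - 1) (s := Finset.range (n - i'))]
      · simp
      · rw [Finset.mem_range]; omega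
      · have : ((i - (k + d) - 1 : ℕ) : ℝ) + 1 = i - k - d := by
          have : (i - (k + d) - 1) + 1 + k + d = i := by omega
          have := congrArg (Nat.cast : ℕ → ℝ) this
          push_cast at this
          linarith
        rw [this]; ring
    have : Q.eval (i : ℝ) = 0 := by simpa using this
    simp [hg, this]
  have hgn : ∀ i, n + d < i → g i = 0 := by
    intro i h
    simp [hg, Nat.choose_eq_zero_of_lt h]
  rw [Finset.Nat.sum_antidiagonal_eq_sum_range_succ_mk]
  calc _ = ∑ i ∈ Finset.range (k + d + 1), (-1) ^ (n + i') * (N + d).factorial * g i :=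
        Finset.sum_congr rfl fun i hi => hterm i (by simpa [Nat.lt_succ_iff] using hi)
    _ = (-1) ^ (n + i') * (N + d).factorial * ∑ i ∈ Finset.range (n + d + 1), g i := by
        rw [← Finset.mul_sum]
        congr 1
        rw [Finset.sum_subset (s₂ := Finset.range (n + d + 1 + (k + d + 1))),
          Finset.sum_subset (s₁ := Finset.range (n + d + 1))
            (s₂ := Finset.range (n + d + 1 + (k + d + 1)))]
        · intro x hx; simp at hx ⊢; omega
        · intro x _ hx
          exact hgn x (by simp at hx; omega)
        · intro x hx; simp at hx ⊢; omega
        · intro x _ hx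
          by_cases h : x ≤ n + d
          · exact hgk x (by simp at hx; omega) h
          · exact hgn x (by omega)
    _ = _ := by
        rw [sum_neg_one_pow_choose_mul_eval hQ (by omega), hdeg]
        by_cases h : d = 0
        · subst h; simp; ring
        · simp [h]

lemma hasDerivAt_cos_pow_mul_sin_pow (p q : ℕ) (θ : ℝ) :
    HasDerivAt (fun θ => Real.cos (θ / 2) ^ (2 * p + 2) * Real.sin (θ / 2) ^ (2 * q + 2))
      ((q + 1) * (Real.cos (θ / 2) ^ (2 * p + 3) * Real.sin (θ / 2) ^ (2 * q + 1)) -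
        (p + 1) * (Real.cos (θ / 2) ^ (2 * p + 1) * Real.sin (θ / 2) ^ (2 * q + 3))) θ := by
  have h := (hasDerivAt_id θ).div_const 2
  refine ((h.cos.pow (2 * p + 2)).mul (h.sin.pow (2 * q + 2))).congr_deriv ?_
  simp
  ring

/-- A trigonometric form of the Beta integral. -/
lemma integral_cos_pow_mul_sin_pow (p q : ℕ) :
    ∫ θ in (0 : ℝ)..Real.pi, Real.cos (θ / 2) ^ (2 * p + 1) * Real.sin (θ / 2) ^ (2 * q + 1) =
      p.factorial * q.factorial / (p + q + 1).factorial := by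
  have hint : ∀ a b : ℕ, IntervalIntegrable
      (fun θ => Real.cos (θ / 2) ^ a * Real.sin (θ / 2) ^ b) volume 0 Real.pi := fun a b =>
    Continuous.intervalIntegrable (by fun_prop) _ _
  induction p generalizing q with
  | zero =>
    have hd : ∀ θ ∈ Set.uIcc 0 Real.pi, HasDerivAt
        (fun θ => Real.sin (θ / 2) ^ (2 * q + 2) / (q + 1))
        (Real.cos (θ / 2) ^ (2 * 0 + 1) * Real.sin (θ / 2) ^ (2 * q + 1)) θ := by
      intro θ _
      have h := (hasDerivAt_id θ).div_const 2
      refine ((h.sin.pow (2 * q + 2)).div_const _).congr_deriv ?_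
      have : (q : ℝ) + 1 ≠ 0 := by positivity
      simp
      field_simp
    rw [intervalIntegral.integral_eq_sub_of_hasDerivAt hd (hint _ _)]
    have : (q : ℝ) + 1 ≠ 0 := by positivity
    have : (q.factorial : ℝ) ≠ 0 := by positivity
    simp [Nat.factorial_succ]
    field_simp
  | succ p ih =>
    have h1 := intervalIntegral.integral_eq_sub_of_hasDerivAt (a := 0) (b := Real.pi)
      (fun θ _ => hasDerivAt_cos_pow_mul_sin_pow p q θ)
      (((hint _ _).const_mul _).sub ((hint _ _).const_mul _))
    rw [intervalIntegral.integral_sub ((hint _ _).const_mul _) ((hint _ _).const_mul _),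
      intervalIntegral.integral_const_mul, intervalIntegral.integral_const_mul] at h1
    have h2 : (∫ θ in (0 : ℝ)..Real.pi,
          Real.cos (θ / 2) ^ (2 * p + 3) * Real.sin (θ / 2) ^ (2 * q + 1)) +
        (∫ θ in (0 : ℝ)..Real.pi,
          Real.cos (θ / 2) ^ (2 * p + 1) * Real.sin (θ / 2) ^ (2 * q + 3)) =
        ∫ θ in (0 : ℝ)..Real.pi,
          Real.cos (θ / 2) ^ (2 * p + 1) * Real.sin (θ / 2) ^ (2 * q + 1) := by
      rw [← intervalIntegral.integral_add (hint _ _) (hint _ _)]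
      congr 1
      ext θ
      linear_combination (Real.cos (θ / 2) ^ (2 * p + 1) * Real.sin (θ / 2) ^ (2 * q + 1)) *
        Real.sin_sq_add_cos_sq (θ / 2)
    rw [ih q] at h2
    simp at h1
    rw [show 2 * (p + 1) + 1 = 2 * p + 3 by ring, show p + 1 + q + 1 = (p + q + 1) + 1 by ring,
      Nat.factorial_succ (p + q + 1), Nat.factorial_succ p]
    have h3 : ((p + q + 1).factorial : ℝ) ≠ 0 := by positivity
    have h4 : (p : ℝ) + q + 1 + 1 ≠ 0 := by positivity
    rw [eq_div_iff (by push_cast; positivity)]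
    rw [eq_div_iff h3] at h2
    push_cast
    linear_combination ((p + q + 1).factorial : ℝ) * h1 + (p + 1 : ℝ) * h2

/-- The `θ`-dependent factor of a spin-weighted harmonic, up to normalization: the coefficient of
`z ^ k` in `(cos (θ / 2) z - sin (θ / 2)) ^ n (sin (θ / 2) z + cos (θ / 2)) ^ N`. -/
def spinPoly (n N k : ℕ) (θ : ℝ) : ℝ :=
  ∑ ij ∈ Finset.HasAntidiagonal.antidiagonal k,
    (-1) ^ (n + ij.1) * n.choose ij.1 * N.choose ij.2 *
      (Real.cos (θ / 2) ^ (ij.1 + (N - ij.2)) * Real.sin (θ / 2) ^ (n - ij.1 + ij.2))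

@[fun_prop]
lemma continuous_spinPoly (n N k : ℕ) : Continuous (spinPoly n N k) := by
  unfold spinPoly
  fun_prop

lemma integral_spinPoly_mul_monomial (n N k d i' j' : ℕ) (hi : i' ≤ n) (hj : j' ≤ N)
    (hk : i' + j' = k) :
    ∫ θ in (0 : ℝ)..Real.pi, spinPoly (n + d) (N + d) (k + d) θ *
      (Real.cos (θ / 2) ^ (i' + (N - j')) * Real.sin (θ / 2) ^ (n - i' + j')) * Real.sin θ =
      if d = 0 then (-1 : ℝ) ^ (n + i') * (2 * n.factorial * N.factorial / (n + N + 1).factorial)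
      else 0 := by
  have hterm : ∀ ij ∈ Finset.HasAntidiagonal.antidiagonal (k + d),
      ∫ θ in (0 : ℝ)..Real.pi, (-1 : ℝ) ^ (n + d + ij.1) * (n + d).choose ij.1 *
        (N + d).choose ij.2 *
          (Real.cos (θ / 2) ^ (ij.1 + (N + d - ij.2)) *
            Real.sin (θ / 2) ^ (n + d - ij.1 + ij.2)) *
          (Real.cos (θ / 2) ^ (i' + (N - j')) * Real.sin (θ / 2) ^ (n - i' + j')) * Real.sin θ =
        2 / (n + N + d + 1).factorial *
          ((-1 : ℝ) ^ (n + d + ij.1) * (n + d).choose ij.1 * (N + d).choose ij.2 *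
            ((i' + (N + d - ij.2)).factorial * (ij.2 + (n - i')).factorial)) := by
    rintro ⟨i, j⟩ hij
    rw [Finset.HasAntidiagonal.mem_antidiagonal] at hij
    dsimp only at hij ⊢
    by_cases h1 : i ≤ n + d
    swap
    · simp [Nat.choose_eq_zero_of_lt (not_le.1 h1)]
    by_cases h2 : j ≤ N + d
    swap
    · simp [Nat.choose_eq_zero_of_lt (not_le.1 h2)]
    have hcalc : ∀ θ : ℝ, (-1 : ℝ) ^ (n + d + i) * (n + d).choose i * (N + d).choose j *
          (Real.cos (θ / 2) ^ (i + (N + d - j)) * Real.sin (θ / 2) ^ (n + d - i + j)) *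
          (Real.cos (θ / 2) ^ (i' + (N - j')) * Real.sin (θ / 2) ^ (n - i' + j')) * Real.sin θ =
        ((-1 : ℝ) ^ (n + d + i) * (n + d).choose i * (N + d).choose j * 2) *
          (Real.cos (θ / 2) ^ (2 * (i' + (N + d - j)) + 1) *
            Real.sin (θ / 2) ^ (2 * (j + (n - i')) + 1)) := by
      intro θ
      have hs : Real.sin θ = 2 * Real.sin (θ / 2) * Real.cos (θ / 2) := by
        rw [← Real.sin_two_mul]; ring_nf
      rw [hs, show 2 * (i' + (N + d - j)) + 1 = (i + (N + d - j)) + (i' + (N - j')) + 1 by omega,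
        show 2 * (j + (n - i')) + 1 = (n + d - i + j) + (n - i' + j') + 1 by omega]
      ring
    simp only [hcalc]
    rw [intervalIntegral.integral_const_mul, integral_cos_pow_mul_sin_pow,
      show i' + (N + d - j) + (j + (n - i')) + 1 = n + N + d + 1 by omega]
    ring
  have hsum : ∀ θ : ℝ, spinPoly (n + d) (N + d) (k + d) θ *
      (Real.cos (θ / 2) ^ (i' + (N - j')) * Real.sin (θ / 2) ^ (n - i' + j')) * Real.sin θ =
      ∑ ij ∈ Finset.HasAntidiagonal.antidiagonal (k + d),
        (-1 : ℝ) ^ (n + d + ij.1) * (n + d).choose ij.1 * (N + d).choose ij.2 *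
          (Real.cos (θ / 2) ^ (ij.1 + (N + d - ij.2)) *
            Real.sin (θ / 2) ^ (n + d - ij.1 + ij.2)) *
          (Real.cos (θ / 2) ^ (i' + (N - j')) * Real.sin (θ / 2) ^ (n - i' + j')) *
            Real.sin θ := by
    intro θ
    rw [spinPoly, Finset.sum_mul, Finset.sum_mul]
  simp only [hsum]
  rw [intervalIntegral.integral_finsetSum
    fun ij _ => Continuous.intervalIntegrable (by fun_prop) _ _,
    Finset.sum_congr rfl hterm, ← Finset.mul_sum,
    sum_antidiagonal_choose_mul_factorial n N k d i' j' hi hj hk]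
  split_ifs with h
  · subst h
    rw [Nat.add_zero]
    ring
  · simp

lemma integral_spinPoly_mul_spinPoly (n N k d : ℕ) :
    ∫ θ in (0 : ℝ)..Real.pi,
      spinPoly (n + d) (N + d) (k + d) θ * spinPoly n N k θ * Real.sin θ =
      if d = 0 then
        2 * n.factorial * N.factorial / (n + N + 1).factorial * ((n + N).choose k : ℝ)
      else 0 := by
  have hsum : ∀ θ : ℝ, spinPoly (n + d) (N + d) (k + d) θ * spinPoly n N k θ * Real.sin θ =
      ∑ ij ∈ Finset.HasAntidiagonal.antidiagonal k,
        ((-1) ^ (n + ij.1) * n.choose ij.1 * N.choose ij.2) *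
        (spinPoly (n + d) (N + d) (k + d) θ *
          (Real.cos (θ / 2) ^ (ij.1 + (N - ij.2)) * Real.sin (θ / 2) ^ (n - ij.1 + ij.2)) *
            Real.sin θ) := by
    intro θ
    conv_lhs => rw [spinPoly.eq_def n N k, Finset.mul_sum, Finset.sum_mul]
    exact Finset.sum_congr rfl fun _ _ => by ring
  simp only [hsum]
  rw [intervalIntegral.integral_finsetSum
    fun ij _ => Continuous.intervalIntegrable (by fun_prop) _ _]
  simp only [intervalIntegral.integral_const_mul]
  have hterm : ∀ ij ∈ Finset.HasAntidiagonal.antidiagonal k,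
      ((-1) ^ (n + ij.1) * n.choose ij.1 * N.choose ij.2) *
        (∫ θ in (0 : ℝ)..Real.pi, spinPoly (n + d) (N + d) (k + d) θ *
          (Real.cos (θ / 2) ^ (ij.1 + (N - ij.2)) * Real.sin (θ / 2) ^ (n - ij.1 + ij.2)) *
            Real.sin θ) =
      (if d = 0 then (2 * n.factorial * N.factorial / (n + N + 1).factorial : ℝ) else 0) *
        ((n.choose ij.1 * N.choose ij.2 : ℕ) : ℝ) := by
    rintro ⟨i, j⟩ hij
    rw [Finset.HasAntidiagonal.mem_antidiagonal] at hij
    dsimp only at hij ⊢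
    by_cases h1 : i ≤ n
    swap
    · simp [Nat.choose_eq_zero_of_lt (not_le.1 h1)]
    by_cases h2 : j ≤ N
    swap
    · simp [Nat.choose_eq_zero_of_lt (not_le.1 h2)]
    rw [integral_spinPoly_mul_monomial n N k d i j h1 h2 hij]
    have hs : (-1 : ℝ) ^ (n + i) * (-1) ^ (n + i) = 1 := by rw [← mul_pow]; simp
    split_ifs
    · push_cast
      linear_combination (n.choose i * N.choose j *
        (2 * n.factorial * N.factorial / (n + N + 1).factorial : ℝ)) * hs
    · simp
  rw [Finset.sum_congr rfl hterm, ← Finset.mul_sum, ← Nat.cast_sum, ← Nat.add_choose_eq]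
  split_ifs <;> simp

/-- The normalization constant of `sY s l m`, with its sign. -/
def sYConst (s l m : ℤ) : ℝ :=
  (-1) ^ (max (-m) 0) *
    (alm l m / Real.sqrt (((l + s).toNat.factorial : ℝ) * ((l - s).toNat.factorial : ℝ)))

lemma izbinom_natCast_add_sub (N k r : ℕ) :
    izbinom N (r + N - k) = if r ≤ k then N.choose (k - r) else 0 := by
  unfold izbinom
  split_ifs with h1 h2 h2
  · rw [Int.toNat_natCast, ← Nat.choose_symm (n := N) (k := k - r) (by omega)]
    congr 1
    omega
  · omega
  · rw [Nat.choose_eq_zero_of_lt (by omega)]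
  · rfl

lemma sY_eq_s4 {s l m : ℤ} (hs : |s| ≤ l) (hm : -l ≤ m) {x : ℝ × ℝ}
    (hx : 0 < Real.sin (x.1 / 2)) :
    sY s l m x = (sYConst s l m : ℂ) * (Complex.exp (Complex.I * m * x.2) *
      (spinPoly (l - s).toNat (l + s).toNat (l + m).toNat x.1 : ℂ)) := by
  obtain ⟨hs1, hs2⟩ := abs_le.1 hs
  obtain ⟨n, hn⟩ := Int.eq_ofNat_of_zero_le (show 0 ≤ l - s by omega)
  obtain ⟨N, hN⟩ := Int.eq_ofNat_of_zero_le (show 0 ≤ l + s by omega)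
  obtain ⟨k, hk⟩ := Int.eq_ofNat_of_zero_le (show 0 ≤ l + m by omega)
  suffices h : ((Real.sin (x.1 / 2) : ℂ)) ^ (2 * l) *
      ∑ r ∈ Finset.Icc (0 : ℤ) (l - s),
      (izbinom (l - s) r : ℂ) * (izbinom (l + s) (r + s - m) : ℂ) * (-1 : ℂ) ^ (l - r - s) *
        ((Real.cos (x.1 / 2) / Real.sin (x.1 / 2) : ℝ) : ℂ) ^ (2 * r + s - m) =
      (spinPoly (l - s).toNat (l + s).toNat (l + m).toNat x.1 : ℂ) by
    rw [sY, mul_assoc, h, sYConst]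
    push_cast
    ring
  rw [hn, hN, hk]
  simp only [Int.toNat_natCast]
  have hS : (Real.sin (x.1 / 2) : ℂ) ≠ 0 := by exact_mod_cast hx.ne'
  have hIcc : Finset.Icc (0 : ℤ) n = (Finset.range (n + 1)).map Nat.castEmbedding := by
    ext a
    simp only [Finset.mem_Icc, Finset.mem_map, Finset.mem_range, Nat.castEmbedding_apply]
    constructor
    · intro h
      exact ⟨a.toNat, by omega, by omega⟩
    · rintro ⟨b, hb, rfl⟩
      omega
  rw [hIcc, Finset.sum_map, Finset.mul_sum, spinPoly,
    Finset.Nat.sum_antidiagonal_eq_sum_range_succ_mk]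
  push_cast
  set g : ℕ → ℂ := fun i => if i ≤ k then (-1 : ℂ) ^ (n + i) * (n.choose i : ℂ) *
    (N.choose (k - i) : ℂ) * (Complex.cos (x.1 / 2) ^ (i + (N - (k - i))) *
      Complex.sin (x.1 / 2) ^ (n - i + (k - i))) else 0 with hg
  rw [Finset.sum_congr (g := g) rfl, Finset.sum_congr (s₁ := Finset.range (k + 1)) (g := g) rfl,
    Finset.sum_subset (s₁ := Finset.range (n + 1)) (s₂ := Finset.range (n + 1 + (k + 1))),
    Finset.sum_subset (s₁ := Finset.range (k + 1)) (s₂ := Finset.range (n + 1 + (k + 1)))]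
  · intro i hi; simp at hi ⊢; omega
  · intro i _ hi
    rw [if_neg (by simp at hi; omega)]
  · intro i hi; simp at hi ⊢; omega
  · intro i _ hi
    rw [Nat.choose_eq_zero_of_lt (by simp at hi; omega)]
    simp
  · intro i hi
    simp only [hg]
    rw [if_pos (by simp at hi; omega)]
  · intro i hi
    have hin : i ≤ n := by simp at hi; omega
    simp only [hg, Nat.castEmbedding_apply]
    have e1 : izbinom n i = n.choose i := by
      simp [izbinom, hin]
    rw [e1, show (i : ℤ) + s - m = i + N - k by omega, izbinom_natCast_add_sub]
    split_ifs with hik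
    swap
    · simp
    by_cases hN' : k - i ≤ N
    swap
    · simp [Nat.choose_eq_zero_of_lt (not_le.1 hN')]
    rw [show 2 * (i : ℤ) + s - m = ((i + (N - (k - i)) : ℕ) : ℤ) by omega,
      show l - i - s = ((n - i : ℕ) : ℤ) by omega,
      show 2 * l = ((i + (N - (k - i)) + (n - i + (k - i)) : ℕ) : ℤ) by omega,
      zpow_natCast, zpow_natCast, zpow_natCast]
    have : (-1 : ℂ) ^ (n + i) = (-1) ^ (n - i) := by
      obtain ⟨j, rfl⟩ := Nat.exists_eq_add_of_le hin
      rw [Nat.add_sub_cancel_left, show i + j + i = 2 * i + j by ring, pow_add, pow_mul]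
      simp
    rw [this, div_pow, pow_add (Complex.sin _)]
    push_cast at hS
    field_simp

lemma sYConst_sq_mul {s l m : ℤ} (hs : |s| ≤ l) (hm : -l ≤ m) (hm' : m ≤ l) :
    sYConst s l m ^ 2 * (2 * Real.pi * (2 * (l - s).toNat.factorial * (l + s).toNat.factorial /
      ((l - s).toNat + (l + s).toNat + 1).factorial *
        (((l - s).toNat + (l + s).toNat).choose (l + m).toNat : ℝ))) = 1 := by
  obtain ⟨hs1, hs2⟩ := abs_le.1 hs
  have hl : (0 : ℝ) ≤ l := by exact_mod_cast (by omega : 0 ≤ l)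
  have hsgn : ((-1 : ℝ) ^ (max (-m) 0)) ^ 2 = 1 := by
    rw [← zpow_natCast, ← zpow_mul, mul_comm, zpow_mul]
    simp
  have hch := Nat.choose_mul_factorial_mul_factorial
    (show (l + m).toNat ≤ (l - s).toNat + (l + s).toNat by omega)
  rw [show (l - s).toNat + (l + s).toNat - (l + m).toNat = (l - m).toNat by omega] at hch
  have hch' := congrArg (Nat.cast : ℕ → ℝ) hch
  push_cast at hch'
  rw [Nat.factorial_succ, sYConst, mul_pow, hsgn, div_pow, alm, Real.sq_sqrt (by positivity),
    Real.sq_sqrt (by positivity)]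
  have h2 : (((l - s).toNat + (l + s).toNat + 1 : ℕ) : ℝ) = 2 * l + 1 := by
    have : (((l - s).toNat + (l + s).toNat + 1 : ℕ) : ℤ) = 2 * l + 1 := by omega
    exact_mod_cast congrArg (Int.cast : ℤ → ℝ) this
  rw [Nat.cast_mul, h2, ← hch']
  have h3 : (((l - s).toNat + (l + s).toNat).choose (l + m).toNat : ℝ) ≠ 0 := by
    have := Nat.choose_pos (show (l + m).toNat ≤ (l - s).toNat + (l + s).toNat by omega)
    exact_mod_cast this.ne'
  have := Real.pi_pos
  field_simp
  norm_num

lemma integral_exp_I_mul_int (m : ℤ) :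
    ∫ φ in (-Real.pi)..Real.pi, Complex.exp (Complex.I * m * φ) =
      if m = 0 then 2 * (Real.pi : ℂ) else 0 := by
  split_ifs with h
  · subst h
    simp
    ring
  · have hc : Complex.I * (m : ℂ) ≠ 0 := by simp [h]
    rw [integral_exp_mul_complex hc, div_eq_zero_iff]
    left
    rw [sub_eq_zero, Complex.exp_eq_exp_iff_exists_int]
    refine ⟨m, ?_⟩
    push_cast
    ring

lemma integral_spinPoly_int (s m l l' : ℤ) (hs : |s| ≤ l) (hm : -l ≤ m)
    (hs' : |s| ≤ l') (hm' : -l' ≤ m) :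
    ∫ θ in (0 : ℝ)..Real.pi, spinPoly (l - s).toNat (l + s).toNat (l + m).toNat θ *
        spinPoly (l' - s).toNat (l' + s).toNat (l' + m).toNat θ * Real.sin θ =
      if l = l' then
        2 * (l - s).toNat.factorial * (l + s).toNat.factorial /
          ((l - s).toNat + (l + s).toNat + 1).factorial *
            (((l - s).toNat + (l + s).toNat).choose (l + m).toNat : ℝ)
      else 0 := by
  obtain ⟨h1, h2⟩ := abs_le.1 hs
  obtain ⟨h3, h4⟩ := abs_le.1 hs'
  rcases le_total l' l with h | h
  · obtain ⟨d, hd⟩ := Int.le.dest h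
    rw [show (l - s).toNat = (l' - s).toNat + d by omega,
      show (l + s).toNat = (l' + s).toNat + d by omega,
      show (l + m).toNat = (l' + m).toNat + d by omega, integral_spinPoly_mul_spinPoly]
    by_cases hd0 : d = 0
    · subst hd0
      rw [if_pos rfl, if_pos (by omega)]
      simp
    · rw [if_neg hd0, if_neg (by omega)]
  · obtain ⟨d, hd⟩ := Int.le.dest h
    have hcomm : ∀ θ : ℝ, spinPoly (l - s).toNat (l + s).toNat (l + m).toNat θ *
        spinPoly (l' - s).toNat (l' + s).toNat (l' + m).toNat θ * Real.sin θ =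
        spinPoly (l' - s).toNat (l' + s).toNat (l' + m).toNat θ *
        spinPoly (l - s).toNat (l + s).toNat (l + m).toNat θ * Real.sin θ := fun θ => by ring
    simp only [hcomm]
    rw [show (l' - s).toNat = (l - s).toNat + d by omega,
      show (l' + s).toNat = (l + s).toNat + d by omega,
      show (l' + m).toNat = (l + m).toNat + d by omega, integral_spinPoly_mul_spinPoly]
    by_cases hd0 : d = 0
    · subst hd0
      rw [if_pos rfl, if_pos (by omega)]
    · rw [if_neg hd0, if_neg (by omega)]

/-- The domain of the standard chart of the sphere. -/
def chartDomain : Set (ℝ × ℝ) := Set.Ioo (0 : ℝ) Real.pi ×ˢ Set.Ioo (-Real.pi) Real.pi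

lemma isOpen_chartDomain : IsOpen chartDomain := isOpen_Ioo.prod isOpen_Ioo

lemma ae_mem_chartDomain : ∀ᵐ x ∂sphMeas, x ∈ chartDomain :=
  (withDensity_absolutelyContinuous _ _).ae_le
    (ae_restrict_mem isOpen_chartDomain.measurableSet)

lemma measurable_ofReal_sin_fst :
    Measurable fun x : ℝ × ℝ => ENNReal.ofReal (Real.sin x.1) := by fun_prop

lemma sin_fst_pos {x : ℝ × ℝ} (hx : x ∈ chartDomain) : 0 < Real.sin x.1 :=
  Real.sin_pos_of_pos_of_lt_pi hx.1.1 hx.1.2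

lemma sin_half_fst_pos {x : ℝ × ℝ} (hx : x ∈ chartDomain) : 0 < Real.sin (x.1 / 2) :=
  Real.sin_pos_of_pos_of_lt_pi (by linarith [hx.1.1]) (by linarith [hx.1.1, hx.1.2])

lemma cos_half_fst_pos {x : ℝ × ℝ} (hx : x ∈ chartDomain) : 0 < Real.cos (x.1 / 2) :=
  Real.cos_pos_of_mem_Ioo ⟨by linarith [hx.1.1, Real.pi_pos], by linarith [hx.1.2]⟩

lemma integral_sphMeas (f : ℝ × ℝ → ℂ) :
    ∫ x, f x ∂sphMeas = ∫ x in chartDomain, (Real.sin x.1 : ℂ) * f x := by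
  rw [sphMeas, integral_withDensity_eq_integral_toReal_smul measurable_ofReal_sin_fst (by simp)]
  refine setIntegral_congr_fun isOpen_chartDomain.measurableSet fun x hx => ?_
  simp only [ENNReal.toReal_ofReal (sin_fst_pos hx).le, Complex.real_smul]

lemma integrable_sphMeas_iff {f : ℝ × ℝ → ℂ} :
    Integrable f sphMeas ↔
      IntegrableOn (fun x => (Real.sin x.1 : ℂ) * f x) chartDomain := by
  rw [sphMeas, integrable_withDensity_iff_integrable_smul' measurable_ofReal_sin_fst (by simp)]
  refine integrable_congr ?_
  filter_upwards [ae_restrict_mem isOpen_chartDomain.measurableSet] with x hx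
  simp only [ENNReal.toReal_ofReal (sin_fst_pos hx).le, Complex.real_smul]

lemma integral_sphMeas_prod (f g : ℝ → ℂ) :
    ∫ x, f x.1 * g x.2 ∂sphMeas =
      (∫ θ in (0 : ℝ)..Real.pi, f θ * (Real.sin θ : ℂ)) *
        ∫ φ in (-Real.pi)..Real.pi, g φ := by
  rw [integral_sphMeas, chartDomain, intervalIntegral.integral_of_le Real.pi_pos.le,
    intervalIntegral.integral_of_le (by linarith [Real.pi_pos]), integral_Ioc_eq_integral_Ioo,
    integral_Ioc_eq_integral_Ioo, Measure.volume_eq_prod, ← setIntegral_prod_mul]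
  congr 1
  ext x
  ring

instance : IsFiniteMeasure sphMeas := by
  refine ⟨?_⟩
  rw [sphMeas, withDensity_apply _ MeasurableSet.univ, Measure.restrict_univ]
  calc _ ≤ ∫⁻ _ in Set.Ioo (0 : ℝ) Real.pi ×ˢ Set.Ioo (-Real.pi) Real.pi, (1 : ENNReal) :=
        lintegral_mono fun x => by
          rw [← ENNReal.ofReal_one]
          exact ENNReal.ofReal_le_ofReal (Real.sin_le_one _)
    _ < ⊤ := by
        rw [setLIntegral_one, Measure.volume_eq_prod, Measure.prod_prod]
        exact ENNReal.mul_lt_top (by simp) (by simp)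

lemma memLp_sphMeas_of_continuous {f : ℝ × ℝ → ℂ} (hf : Continuous f) (p : ENNReal) :
    MemLp f p sphMeas := by
  obtain ⟨C, hC⟩ := ((isCompact_Icc (a := (0 : ℝ)) (b := Real.pi)).prod
    (isCompact_Icc (a := -Real.pi) (b := Real.pi))).exists_bound_of_continuousOn
      hf.continuousOn
  refine MemLp.of_bound hf.aestronglyMeasurable C ?_
  filter_upwards [ae_mem_chartDomain] with x hx
  exact hC x ⟨Set.Ioo_subset_Icc_self hx.1, Set.Ioo_subset_Icc_self hx.2⟩

/-- The continuous extension of `sY s l m` from the chart to the plane. -/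
def sYExt (s l m : ℤ) (x : ℝ × ℝ) : ℂ :=
  (sYConst s l m : ℂ) * (Complex.exp (Complex.I * m * x.2) *
    (spinPoly (l - s).toNat (l + s).toNat (l + m).toNat x.1 : ℂ))

lemma continuous_sYExt (s l m : ℤ) : Continuous (sYExt s l m) := by
  unfold sYExt
  have h : Continuous fun x : ℝ × ℝ =>
      spinPoly (l - s).toNat (l + s).toNat (l + m).toNat x.1 := by fun_prop
  fun_prop

lemma sYExt_ae_eq {s l m : ℤ} (hs : |s| ≤ l) (hm : -l ≤ m) :
    sYExt s l m =ᵐ[sphMeas] fun x => sY s l m x := by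
  filter_upwards [ae_mem_chartDomain] with x hx
  rw [sY_eq_s4 hs hm (sin_half_fst_pos hx), sYExt]

lemma conj_exp_I_mul_int (m : ℤ) (φ : ℝ) :
    (starRingEnd ℂ) (Complex.exp (Complex.I * m * φ)) =
      Complex.exp (Complex.I * (-m : ℤ) * φ) := by
  rw [← Complex.exp_conj]
  simp

lemma integral_conj_sYExt_mul {s l m l' m' : ℤ} (hs : |s| ≤ l) (hm : -l ≤ m) (hm2 : m ≤ l)
    (hs' : |s| ≤ l') (hm' : -l' ≤ m') :
    ∫ x, (starRingEnd ℂ) (sYExt s l m x) * sYExt s l' m' x ∂sphMeas =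
      if l = l' ∧ m = m' then 1 else 0 := by
  have hsplit : ∀ x : ℝ × ℝ, (starRingEnd ℂ) (sYExt s l m x) * sYExt s l' m' x =
      (fun θ : ℝ => (sYConst s l m : ℂ) * sYConst s l' m' *
        (spinPoly (l - s).toNat (l + s).toNat (l + m).toNat θ *
          spinPoly (l' - s).toNat (l' + s).toNat (l' + m').toNat θ)) x.1 *
      (fun φ : ℝ => Complex.exp (Complex.I * (m' - m : ℤ) * φ)) x.2 := by
    intro x
    have : Complex.exp (Complex.I * (m' - m : ℤ) * x.2) =
        Complex.exp (Complex.I * (-m : ℤ) * x.2) * Complex.exp (Complex.I * m' * x.2) := by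
      rw [← Complex.exp_add]
      congr 1
      push_cast
      ring
    simp only [sYExt, map_mul, conj_exp_I_mul_int, Complex.conj_ofReal, this]
    ring

  rw [integral_congr_ae (.of_forall hsplit)]
  refine (integral_sphMeas_prod (fun θ : ℝ => (sYConst s l m : ℂ) * sYConst s l' m' *
    (spinPoly (l - s).toNat (l + s).toNat (l + m).toNat θ *
      spinPoly (l' - s).toNat (l' + s).toNat (l' + m').toNat θ))
    (fun φ : ℝ => Complex.exp (Complex.I * (m' - m : ℤ) * φ))).trans ?_
  rw [integral_exp_I_mul_int]
  by_cases hmm : m = m'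
  · subst hmm
    have hreal : ∀ θ : ℝ, (sYConst s l m : ℂ) * sYConst s l' m *
        (spinPoly (l - s).toNat (l + s).toNat (l + m).toNat θ *
          spinPoly (l' - s).toNat (l' + s).toNat (l' + m).toNat θ) * (Real.sin θ : ℂ) =
        ((sYConst s l m * sYConst s l' m *
        (spinPoly (l - s).toNat (l + s).toNat (l + m).toNat θ *
          spinPoly (l' - s).toNat (l' + s).toNat (l' + m).toNat θ * Real.sin θ) : ℝ) : ℂ) := by
      intro θ
      push_cast
      ring
    simp only [hreal]
    rw [intervalIntegral.integral_ofReal, intervalIntegral.integral_const_mul,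
      integral_spinPoly_int s m l l' hs hm hs' hm', sub_self, if_pos rfl]
    by_cases hll : l = l'
    · subst hll
      rw [if_pos rfl, if_pos (by simp)]
      have h := sYConst_sq_mul hs hm hm2
      have h' := congrArg (Complex.ofReal) h
      rw [Complex.ofReal_one] at h'
      rw [← h']
      push_cast
      ring
    · rw [if_neg hll, if_neg (by simp [hll])]
      simp
  · rw [if_neg (sub_ne_zero.2 (Ne.symm hmm)), if_neg (fun h => hmm h.2), mul_zero]

/-- The monomial `e ^ (i m φ) cos (θ / 2) ^ p sin (θ / 2) ^ q`. -/
def expMonomial (m : ℤ) (p q : ℕ) (x : ℝ × ℝ) : ℂ :=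
  Complex.exp (Complex.I * m * x.2) *
    ((Real.cos (x.1 / 2) : ℂ) ^ p * (Real.sin (x.1 / 2) : ℂ) ^ q)

@[fun_prop]
lemma continuous_expMonomial (m : ℤ) (p q : ℕ) : Continuous (expMonomial m p q) := by
  unfold expMonomial
  fun_prop

lemma expMonomial_eq_add (m : ℤ) (p q : ℕ) (x : ℝ × ℝ) :
    expMonomial m p q x = expMonomial m (p + 2) q x + expMonomial m p (q + 2) x := by
  have h : (Real.sin (x.1 / 2) : ℂ) ^ 2 + (Real.cos (x.1 / 2) : ℂ) ^ 2 = 1 := by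
    exact_mod_cast Real.sin_sq_add_cos_sq (x.1 / 2)
  unfold expMonomial
  linear_combination -(Complex.exp (Complex.I * m * x.2) *
    ((Real.cos (x.1 / 2) : ℂ) ^ p * (Real.sin (x.1 / 2) : ℂ) ^ q)) * h

lemma integrable_continuous_mul {f g : ℝ × ℝ → ℂ} (hf : Continuous f)
    (hg : Integrable g sphMeas) : Integrable (fun x => f x * g x) sphMeas := by
  have h := memLp_sphMeas_of_continuous hf ⊤
  have := hg.mul_of_top_right h
  exact this

lemma sYConst_ne_zero {s l m : ℤ} (hs : |s| ≤ l) (hm : -l ≤ m) (hm' : m ≤ l) :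
    sYConst s l m ≠ 0 := by
  intro h
  have := sYConst_sq_mul hs hm hm'
  simp [h] at this

lemma integral_conj_sYExt_mul_eq_sum {g : ℝ × ℝ → ℂ} (hg : Integrable g sphMeas) (s l m : ℤ) :
    ∫ x, (starRingEnd ℂ) (sYExt s l m x) * g x ∂sphMeas =
      (sYConst s l m : ℂ) * ∑ ij ∈ Finset.HasAntidiagonal.antidiagonal (l + m).toNat,
        (-1) ^ ((l - s).toNat + ij.1) * ((l - s).toNat.choose ij.1 : ℂ) *
          ((l + s).toNat.choose ij.2 : ℂ) *
        ∫ x, expMonomial (-m) (ij.1 + ((l + s).toNat - ij.2)) ((l - s).toNat - ij.1 + ij.2) x *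
          g x ∂sphMeas := by
  have hsum : ∀ x : ℝ × ℝ, (starRingEnd ℂ) (sYExt s l m x) * g x =
      (sYConst s l m : ℂ) * ∑ ij ∈ Finset.HasAntidiagonal.antidiagonal (l + m).toNat,
        (-1) ^ ((l - s).toNat + ij.1) * ((l - s).toNat.choose ij.1 : ℂ) *
          ((l + s).toNat.choose ij.2 : ℂ) *
        (expMonomial (-m) (ij.1 + ((l + s).toNat - ij.2)) ((l - s).toNat - ij.1 + ij.2) x *
          g x) := by
    intro x
    simp only [sYExt, map_mul, conj_exp_I_mul_int, Complex.conj_ofReal]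
    rw [mul_assoc]
    congr 1
    rw [spinPoly, Complex.ofReal_sum, Finset.mul_sum, Finset.sum_mul]
    refine Finset.sum_congr rfl fun ij _ => ?_
    rw [expMonomial]
    push_cast
    ring
  simp only [hsum]
  rw [integral_const_mul, integral_finsetSum _ fun ij _ =>
    (integrable_continuous_mul (continuous_expMonomial _ _ _) hg).const_mul _]
  simp only [integral_const_mul]

lemma integral_expMonomial_eq_zero {g : ℝ × ℝ → ℂ} (hg : Integrable g sphMeas) {s : ℤ}
    (h : ∀ l m : ℤ, |s| ≤ l → -l ≤ m → m ≤ l →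
      ∫ x, (starRingEnd ℂ) (sYExt s l m x) * g x ∂sphMeas = 0) (m : ℤ) (a b : ℕ) :
    ∫ x, expMonomial (-m) ((s - m).natAbs + 2 * a) ((s + m).natAbs + 2 * b) x * g x ∂sphMeas =
      0 := by
  set K : ℕ → ℕ → ℂ := fun a b =>
    ∫ x, expMonomial (-m) ((s - m).natAbs + 2 * a) ((s + m).natAbs + 2 * b) x * g x ∂sphMeas
    with hK
  have hadd : ∀ a b, K a b = K (a + 1) b + K a (b + 1) := by
    intro a b
    simp only [hK]
    rw [← integral_add (integrable_continuous_mul (continuous_expMonomial _ _ _) hg)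
      (integrable_continuous_mul (continuous_expMonomial _ _ _) hg)]
    congr 1
    ext x
    rw [expMonomial_eq_add, add_mul]
    rfl
  suffices hd : ∀ d a b, a + b = d → K a b = 0 from hd (a + b) a b rfl
  have halt : ∀ d, (∀ a b, a + b + 1 = d → K a b = 0) →
      ∀ a b, a + b = d → K a b = (-1) ^ a * K 0 d := by
    intro d ih a
    induction a with
    | zero => intro b hb; obtain rfl : b = d := by omega
              simp
    | succ a iha =>
      intro b hb
      have h1 := hadd a b
      rw [ih a b (by omega), iha (b + 1) (by omega)] at h1
      linear_combination -h1
  have hfin : ∀ d, (∀ a b, a + b = d → K a b = (-1) ^ a * K 0 d) → K 0 d = 0 := by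
    intro d hal
    set l : ℤ := max |s| |m| + d with hl
    have hsl : |s| ≤ l := by have := le_max_left |s| |m|; omega
    have hml : |m| ≤ l := by have := le_max_right |s| |m|; omega
    have hzero := h l m hsl (abs_le.1 hml).1 (abs_le.1 hml).2
    rw [integral_conj_sYExt_mul_eq_sum hg] at hzero
    rw [Int.abs_eq_natAbs, Int.abs_eq_natAbs] at hl
    have hterm : ∀ ij ∈ Finset.HasAntidiagonal.antidiagonal (l + m).toNat,
        (-1) ^ ((l - s).toNat + ij.1) * ((l - s).toNat.choose ij.1 : ℂ) *
          ((l + s).toNat.choose ij.2 : ℂ) *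
        ∫ x, expMonomial (-m) (ij.1 + ((l + s).toNat - ij.2)) ((l - s).toNat - ij.1 + ij.2) x *
          g x ∂sphMeas =
        ((-1) ^ ((l - s).toNat + (m - s).toNat) * K 0 d) *
          (((l - s).toNat.choose ij.1 * (l + s).toNat.choose ij.2 : ℕ) : ℂ) := by
      rintro ⟨i, j⟩ hij
      rw [Finset.HasAntidiagonal.mem_antidiagonal] at hij
      dsimp only at hij ⊢
      by_cases h1 : i ≤ (l - s).toNat
      swap
      · simp [Nat.choose_eq_zero_of_lt (not_le.1 h1)]
      by_cases h2 : j ≤ (l + s).toNat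
      swap
      · simp [Nat.choose_eq_zero_of_lt (not_le.1 h2)]
      obtain ⟨a, ha⟩ : ∃ a, i = (m - s).toNat + a :=
        Nat.exists_eq_add_of_le (by omega)
      obtain ⟨b, hb⟩ : ∃ b, d = a + b :=
        Nat.exists_eq_add_of_le (by omega)
      have hKab : ∫ x, expMonomial (-m) (i + ((l + s).toNat - j)) ((l - s).toNat - i + j) x *
          g x ∂sphMeas = K a b := by
        simp only [hK]
        rw [show i + ((l + s).toNat - j) = (s - m).natAbs + 2 * a by omega,
          show (l - s).toNat - i + j = (s + m).natAbs + 2 * b by omega]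
      rw [hKab, hal a b hb.symm, ha]
      have hsgn : (-1 : ℂ) ^ a * (-1) ^ a = 1 := by rw [← mul_pow]; simp
      push_cast
      rw [pow_add, pow_add, pow_add]
      linear_combination ((-1) ^ (l - s).toNat * (-1) ^ (m - s).toNat *
        ((l - s).toNat.choose ((m - s).toNat + a) : ℂ) * ((l + s).toNat.choose j : ℂ) * K 0 d) *
          hsgn
    rw [Finset.sum_congr rfl hterm, ← Finset.mul_sum, ← Nat.cast_sum, ← Nat.add_choose_eq] at hzero
    have hc : (sYConst s l m : ℂ) ≠ 0 := by
      exact_mod_cast sYConst_ne_zero hsl (abs_le.1 hml).1 (abs_le.1 hml).2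
    have hch : (((l - s).toNat + (l + s).toNat).choose (l + m).toNat : ℂ) ≠ 0 := by
      have := Nat.choose_pos (show (l + m).toNat ≤ (l - s).toNat + (l + s).toNat by omega)
      exact_mod_cast this.ne'
    simpa [hc, hch] using hzero
  intro d
  induction d with
  | zero =>
    intro a b hab
    have h1 := halt 0 (fun a b hab => by omega)
    rw [h1 a b hab, hfin _ h1, mul_zero]
  | succ d ih =>
    intro a b hab
    have h1 := halt (d + 1) (fun a b hab => ih a b (by omega))
    rw [h1 a b hab, hfin _ h1, mul_zero]

lemma integral_expMonomial_mul_cos_pow_eq_zero {g : ℝ × ℝ → ℂ} (hg : Integrable g sphMeas)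
    {s : ℤ} (h : ∀ l m : ℤ, |s| ≤ l → -l ≤ m → m ≤ l →
      ∫ x, (starRingEnd ℂ) (sYExt s l m x) * g x ∂sphMeas = 0) (m : ℤ) (a b k : ℕ) :
    ∫ x, expMonomial (-m) ((s - m).natAbs + 2 * a) ((s + m).natAbs + 2 * b) x *
      (Real.cos x.1 : ℂ) ^ k * g x ∂sphMeas = 0 := by
  induction k generalizing a b with
  | zero => simpa using integral_expMonomial_eq_zero hg h m a b
  | succ k ih =>
    have hsplit : ∀ x : ℝ × ℝ,
        expMonomial (-m) ((s - m).natAbs + 2 * a) ((s + m).natAbs + 2 * b) x *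
          (Real.cos x.1 : ℂ) ^ (k + 1) * g x =
        expMonomial (-m) ((s - m).natAbs + 2 * (a + 1)) ((s + m).natAbs + 2 * b) x *
          (Real.cos x.1 : ℂ) ^ k * g x -
        expMonomial (-m) ((s - m).natAbs + 2 * a) ((s + m).natAbs + 2 * (b + 1)) x *
          (Real.cos x.1 : ℂ) ^ k * g x := by
      intro x
      have hc : (Real.cos x.1 : ℂ) =
          (Real.cos (x.1 / 2) : ℂ) ^ 2 - (Real.sin (x.1 / 2) : ℂ) ^ 2 := by
        have := Real.cos_two_mul' (x.1 / 2)
        rw [mul_div_cancel₀ _ (two_ne_zero)] at this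
        exact_mod_cast this
      rw [pow_succ, hc]
      unfold expMonomial
      ring
    simp only [hsplit]
    rw [integral_sub (integrable_continuous_mul (by fun_prop) hg)
      (integrable_continuous_mul (by fun_prop) hg), ih, ih, sub_zero]

lemma integral_sphere_monomial_eq_zero {g : ℝ × ℝ → ℂ} (hg : Integrable g sphMeas)
    {s : ℤ} (h : ∀ l m : ℤ, |s| ≤ l → -l ≤ m → m ≤ l →
      ∫ x, (starRingEnd ℂ) (sYExt s l m x) * g x ∂sphMeas = 0) (i j k : ℕ) :
    ∫ x, (Real.cos x.1 : ℂ) ^ k * (Real.sin x.1 * Complex.exp (Complex.I * x.2)) ^ i *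
      (Real.sin x.1 * Complex.exp (-(Complex.I * x.2))) ^ j *
        ((Real.cos (x.1 / 2) * Real.sin (x.1 / 2) : ℂ) ^ s.natAbs * g x) ∂sphMeas = 0 := by
  obtain ⟨a, ha⟩ : ∃ a, s.natAbs + (i + j) = (s - (j - i)).natAbs + 2 * a :=
    ⟨(s.natAbs + (i + j) - (s - (j - i)).natAbs) / 2, by omega⟩
  obtain ⟨b, hb⟩ : ∃ b, s.natAbs + (i + j) = (s + (j - i)).natAbs + 2 * b :=
    ⟨(s.natAbs + (i + j) - (s + (j - i)).natAbs) / 2, by omega⟩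
  have key := integral_expMonomial_mul_cos_pow_eq_zero hg h (j - i) a b k
  rw [← ha, ← hb] at key
  have hcalc : ∀ x : ℝ × ℝ,
      (Real.cos x.1 : ℂ) ^ k * (Real.sin x.1 * Complex.exp (Complex.I * x.2)) ^ i *
      (Real.sin x.1 * Complex.exp (-(Complex.I * x.2))) ^ j *
        ((Real.cos (x.1 / 2) * Real.sin (x.1 / 2) : ℂ) ^ s.natAbs * g x) =
      2 ^ (i + j) * (expMonomial (-(j - i)) (s.natAbs + (i + j)) (s.natAbs + (i + j)) x *
        (Real.cos x.1 : ℂ) ^ k * g x) := by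
    intro x
    have hs : (Real.sin x.1 : ℂ) = 2 * (Real.sin (x.1 / 2) : ℂ) * (Real.cos (x.1 / 2) : ℂ) := by
      have := Real.sin_two_mul (x.1 / 2)
      rw [mul_div_cancel₀ _ (two_ne_zero)] at this
      exact_mod_cast this
    have he : Complex.exp (Complex.I * (-(j - i) : ℤ) * x.2) =
        Complex.exp (Complex.I * x.2) ^ i * Complex.exp (-(Complex.I * x.2)) ^ j := by
      rw [← Complex.exp_nat_mul, ← Complex.exp_nat_mul, ← Complex.exp_add]
      congr 1
      push_cast
      ring
    rw [expMonomial, he, hs]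
    ring
  simp only [hcalc]
  rw [integral_const_mul, key, mul_zero]

/-- The closed rectangle whose image under `sphereParam` is the whole sphere. -/
def closedChart : Set (ℝ × ℝ) := Set.Icc (0 : ℝ) Real.pi ×ˢ Set.Icc (-Real.pi) Real.pi

lemma isCompact_closedChart : IsCompact closedChart := isCompact_Icc.prod isCompact_Icc

lemma chartDomain_subset_closedChart : chartDomain ⊆ closedChart :=
  Set.prod_mono Set.Ioo_subset_Icc_self Set.Ioo_subset_Icc_self

/-- Spherical coordinates, with the sphere embedded in `ℝ × ℂ`. -/
def sphereParam (x : ℝ × ℝ) : ℝ × ℂ :=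
  (Real.cos x.1, Real.sin x.1 * Complex.exp (Complex.I * x.2))

@[fun_prop]
lemma continuous_sphereParam : Continuous sphereParam := by
  unfold sphereParam
  fun_prop

lemma sphereParam_eq {x y : ℝ × ℝ} (hx : x ∈ closedChart) (hy : y ∈ closedChart)
    (h : sphereParam x = sphereParam y) : x = y ∨ x ∉ chartDomain := by
  obtain ⟨h1, h2⟩ := Prod.ext_iff.1 h
  have hθ : x.1 = y.1 := Real.injOn_cos hx.1 hy.1 h1
  by_cases hxU : x ∈ chartDomain
  · left
    refine Prod.ext hθ ?_
    have hs : (Real.sin x.1 : ℂ) ≠ 0 := by exact_mod_cast (sin_fst_pos hxU).ne'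
    simp only [sphereParam, ← hθ] at h2
    obtain ⟨n, hn⟩ := Complex.exp_eq_exp_iff_exists_int.1 (mul_left_cancel₀ hs h2)
    have hn' : x.2 = y.2 + n * (2 * Real.pi) := by
      have h3 : Complex.I * (x.2 : ℂ) = Complex.I * ((y.2 + n * (2 * Real.pi) : ℝ) : ℂ) := by
        rw [hn]
        push_cast
        ring
      exact_mod_cast mul_left_cancel₀ Complex.I_ne_zero h3
    have hpi := Real.pi_pos
    have hn1 : (n : ℝ) < 1 := by
      by_contra hc
      nlinarith [hxU.2.1, hxU.2.2, hy.2.1, hy.2.2]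
    have hn2 : (-1 : ℝ) < n := by
      by_contra hc
      nlinarith [hxU.2.1, hxU.2.2, hy.2.1, hy.2.2]
    have hn1' : n < 1 := by exact_mod_cast hn1
    have hn2' : -1 < n := by exact_mod_cast hn2
    obtain rfl : n = 0 := by omega
    simpa using hn'
  · exact Or.inr hxU

lemma exists_sphere_lift {ψ : ℝ × ℝ → ℂ} (hψ : Continuous ψ)
    (hsupp : ∀ x, x ∉ chartDomain → ψ x = 0) :
    ∃ f : C(sphereParam '' closedChart, ℂ), ∀ x (hx : x ∈ closedChart),
      f ⟨sphereParam x, Set.mem_image_of_mem _ hx⟩ = ψ x := by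
  have : CompactSpace closedChart := isCompact_iff_compactSpace.1 isCompact_closedChart
  let P : C(closedChart, sphereParam '' closedChart) :=
    ⟨fun x => ⟨sphereParam x, Set.mem_image_of_mem _ x.2⟩, by fun_prop⟩
  have hP : Topology.IsQuotientMap P := by
    refine Topology.IsQuotientMap.of_surjective_continuous ?_ P.continuous
    rintro ⟨_, x, hx, rfl⟩
    exact ⟨⟨x, hx⟩, rfl⟩
  let g : C(closedChart, ℂ) := ⟨fun x => ψ x, by fun_prop⟩
  have hfac : Function.FactorsThrough g P := by
    intro x y hxy
    have hxy' : sphereParam x = sphereParam y := congrArg Subtype.val hxy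
    change ψ x = ψ y
    rcases sphereParam_eq x.2 y.2 hxy' with h | h
    · rw [h]
    · rcases sphereParam_eq y.2 x.2 hxy'.symm with h' | h'
      · rw [h']
      · rw [hsupp _ h, hsupp _ h']
  refine ⟨hP.lift g hfac, fun x hx => ?_⟩
  exact DFunLike.congr_fun (hP.lift_comp g hfac) ⟨x, hx⟩

lemma exists_retraction_closedChart :
    ∃ ρ : ℝ × ℝ → ℝ × ℝ, Continuous ρ ∧ (∀ x, ρ x ∈ closedChart) ∧
      ∀ x ∈ closedChart, ρ x = x := by
  have h1 : (0 : ℝ) ≤ Real.pi := Real.pi_pos.le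
  have h2 : -Real.pi ≤ Real.pi := by linarith
  refine ⟨fun x => (Set.projIcc 0 Real.pi h1 x.1, Set.projIcc (-Real.pi) Real.pi h2 x.2),
    by fun_prop, fun x => ⟨Subtype.coe_prop _, Subtype.coe_prop _⟩, fun x hx => ?_⟩
  refine Prod.ext ?_ ?_
  · simp [Set.projIcc_of_mem h1 hx.1]
  · simp [Set.projIcc_of_mem h2 hx.2]

/-- An integrable function on the sphere which is orthogonal to all polynomials vanishes. -/
lemma ae_eq_zero_of_integral_sphere_monomial {G : ℝ × ℝ → ℂ} (hG : Integrable G sphMeas)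
    (h : ∀ i j k : ℕ, ∫ x, (Real.cos x.1 : ℂ) ^ k *
      (Real.sin x.1 * Complex.exp (Complex.I * x.2)) ^ i *
      (Real.sin x.1 * Complex.exp (-(Complex.I * x.2))) ^ j * G x ∂sphMeas = 0) :
    G =ᵐ[sphMeas] 0 := by
  have : CompactSpace (sphereParam '' closedChart) :=
    isCompact_iff_compactSpace.1 (isCompact_closedChart.image continuous_sphereParam)
  obtain ⟨ρ, hρc, hρm, hρ⟩ := exists_retraction_closedChart
  let Ψ : ℝ × ℝ → sphereParam '' closedChart :=
    fun x => ⟨sphereParam (ρ x), Set.mem_image_of_mem _ (hρm x)⟩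
  have hΨ : Continuous Ψ := by fun_prop
  have hint : ∀ f : C(sphereParam '' closedChart, ℂ),
      Integrable (fun x => f (Ψ x) * G x) sphMeas := fun f =>
    integrable_continuous_mul (f.continuous.comp hΨ) hG
  let z : C(sphereParam '' closedChart, ℂ) := ⟨fun y => (y.1.1 : ℂ), by fun_prop⟩
  let w : C(sphereParam '' closedChart, ℂ) := ⟨fun y => y.1.2, by fun_prop⟩
  set A : StarSubalgebra ℂ C(sphereParam '' closedChart, ℂ) := StarAlgebra.adjoin ℂ {z, w}
  have hzA : z ∈ A := StarAlgebra.subset_adjoin ℂ _ (by simp)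
  have hwA : w ∈ A := StarAlgebra.subset_adjoin ℂ _ (by simp)
  have hsep : A.SeparatesPoints := by
    intro y y' hne
    by_contra hcon
    push Not at hcon
    have hz := hcon z ⟨z, hzA, rfl⟩
    have hw := hcon w ⟨w, hwA, rfl⟩
    refine hne (Subtype.ext (Prod.ext ?_ hw))
    exact Complex.ofReal_injective hz
  have hdense := ContinuousMap.starSubalgebra_topologicalClosure_eq_top_of_separatesPoints A hsep
  have hmono : ∀ f ∈ Submonoid.closure ({z, w} ∪ star {z, w} :
      Set C(sphereParam '' closedChart, ℂ)), ∃ i j k : ℕ, f = z ^ k * w ^ i * star w ^ j := by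
    intro f hf
    have hzstar : star z = z := by
      ext y
      exact Complex.conj_ofReal _
    induction hf using Submonoid.closure_induction with
    | mem f hf =>
      rcases hf with (rfl | rfl) | hf
      · exact ⟨0, 0, 1, by simp⟩
      · exact ⟨1, 0, 0, by simp⟩
      · rw [Set.mem_star] at hf
        rcases hf with hf | hf
        · exact ⟨0, 0, 1, by rw [← star_star f, hf, hzstar]; simp⟩
        · have hf' : star f = w := hf
          exact ⟨0, 1, 0, by rw [← star_star f, hf']; simp⟩
    | one => exact ⟨0, 0, 0, by simp⟩
    | mul f g _ _ ihf ihg =>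
      obtain ⟨i, j, k, rfl⟩ := ihf
      obtain ⟨i', j', k', rfl⟩ := ihg
      exact ⟨i + i', j + j', k + k', by ring⟩
  have hzero : ∀ f ∈ A, ∫ x, f (Ψ x) * G x ∂sphMeas = 0 := by
    intro f hf
    have hf' : f ∈ Submodule.span ℂ (Submonoid.closure ({z, w} ∪ star {z, w} :
        Set C(sphereParam '' closedChart, ℂ)) : Set C(sphereParam '' closedChart, ℂ)) := by
      rw [← StarAlgebra.adjoin_eq_span]
      exact hf
    clear hf
    induction hf' using Submodule.span_induction with
    | mem f hfm =>
      obtain ⟨i, j, k, rfl⟩ := hmono f hfm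
      rw [← h i j k]
      refine integral_congr_ae ?_
      filter_upwards [ae_mem_chartDomain] with x hx
      have hwx : w (Ψ x) = Real.sin x.1 * Complex.exp (Complex.I * x.2) := by
        change (sphereParam (ρ x)).2 = _
        rw [hρ x (chartDomain_subset_closedChart hx), sphereParam]
      have hzx : z (Ψ x) = Real.cos x.1 := by
        change ((sphereParam (ρ x)).1 : ℂ) = _
        rw [hρ x (chartDomain_subset_closedChart hx), sphereParam]
      have hwsx : (star w) (Ψ x) = Real.sin x.1 * Complex.exp (-(Complex.I * x.2)) := by
        change (starRingEnd ℂ) (w (Ψ x)) = _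
        rw [hwx, map_mul, Complex.conj_ofReal, ← Complex.exp_conj]
        simp
      simp only [ContinuousMap.mul_apply, ContinuousMap.pow_apply, hwx, hzx, hwsx]
    | zero => simp
    | add f g _ _ ihf ihg =>
      simp only [ContinuousMap.add_apply, add_mul]
      rw [integral_add (hint f) (hint g), ihf, ihg, add_zero]
    | smul c f _ ihf =>
      simp only [ContinuousMap.smul_apply, smul_eq_mul, mul_assoc]
      rw [integral_const_mul, ihf, mul_zero]
  have hall : ∀ f : C(sphereParam '' closedChart, ℂ), ∫ x, f (Ψ x) * G x ∂sphMeas = 0 := by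
    intro f
    have hf : f ∈ closure (A : Set C(sphereParam '' closedChart, ℂ)) := by
      rw [← StarSubalgebra.topologicalClosure_coe, hdense]
      trivial
    have hle : ∀ ε > 0, ‖∫ x, f (Ψ x) * G x ∂sphMeas‖ ≤ ε * ∫ x, ‖G x‖ ∂sphMeas := by
      intro ε hε
      obtain ⟨a, ha, hfa⟩ := Metric.mem_closure_iff.1 hf ε hε
      have hsub : ∫ x, f (Ψ x) * G x ∂sphMeas = ∫ x, (f (Ψ x) - a (Ψ x)) * G x ∂sphMeas := by
        simp only [sub_mul]
        rw [integral_sub (hint f) (hint a), hzero a ha, sub_zero]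
      rw [hsub, ← integral_const_mul]
      refine norm_integral_le_of_norm_le (hG.norm.const_mul ε) (.of_forall fun x => ?_)
      rw [norm_mul, ← dist_eq_norm]
      gcongr
      exact (ContinuousMap.dist_apply_le_dist _).trans hfa.le
    have hlim : Filter.Tendsto (fun ε : ℝ => ε * ∫ x, ‖G x‖ ∂sphMeas)
        (nhdsWithin 0 (Set.Ioi 0)) (nhds 0) := by
      have : Filter.Tendsto (fun ε : ℝ => ε * ∫ x, ‖G x‖ ∂sphMeas) (nhds 0)
          (nhds (0 * ∫ x, ‖G x‖ ∂sphMeas)) := Filter.tendsto_id.mul_const _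
      rw [zero_mul] at this
      exact this.mono_left nhdsWithin_le_nhds
    exact norm_le_zero_iff.1 (ge_of_tendsto hlim (by
      filter_upwards [self_mem_nhdsWithin] with ε hε using hle ε hε))
  have hloc : LocallyIntegrableOn (fun x : ℝ × ℝ => (Real.sin x.1 : ℂ) * G x) chartDomain :=
    (integrable_sphMeas_iff.1 hG).locallyIntegrableOn
  have hae := isOpen_chartDomain.ae_eq_zero_of_integral_contDiff_smul_eq_zero hloc (by
    intro ψ hψ _ hsupp
    have hout : ∀ x, x ∉ chartDomain → ψ x = 0 := fun x hx =>
      image_eq_zero_of_notMem_tsupport fun hx' => hx (hsupp hx')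
    obtain ⟨f, hf⟩ := exists_sphere_lift (ψ := fun x => (ψ x : ℂ))
      (Complex.continuous_ofReal.comp hψ.continuous) (fun x hx => by simp [hout x hx])
    rw [← hall f, integral_sphMeas, ← setIntegral_eq_integral_of_forall_compl_eq_zero
      (s := chartDomain) (fun x hx => by simp [hout x hx])]
    refine setIntegral_congr_fun isOpen_chartDomain.measurableSet fun x hx => ?_
    have hx' := chartDomain_subset_closedChart hx
    have hfx : f (Ψ x) = ψ x := by
      rw [← hf x hx']
      congr 1
      exact Subtype.ext (congrArg sphereParam (hρ x hx'))
    simp only [hfx, Complex.real_smul]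
    ring)
  rw [Filter.EventuallyEq, sphMeas]
  refine (withDensity_absolutelyContinuous _ _).ae_le
    ((ae_restrict_iff' (isOpen_Ioo.prod isOpen_Ioo).measurableSet).2 ?_)
  filter_upwards [hae] with x hx hxU
  have hs : (Real.sin x.1 : ℂ) ≠ 0 := by exact_mod_cast (sin_fst_pos hxU).ne'
  exact (mul_eq_zero.1 (hx hxU)).resolve_left hs

lemma ae_eq_zero_of_integral_conj_sYExt_mul {g : ℝ × ℝ → ℂ} (hg : Integrable g sphMeas)
    {s : ℤ} (h : ∀ l m : ℤ, |s| ≤ l → -l ≤ m → m ≤ l →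
      ∫ x, (starRingEnd ℂ) (sYExt s l m x) * g x ∂sphMeas = 0) : g =ᵐ[sphMeas] 0 := by
  have hw := ae_eq_zero_of_integral_sphere_monomial
    (integrable_continuous_mul (f := fun x : ℝ × ℝ =>
      (Real.cos (x.1 / 2) * Real.sin (x.1 / 2) : ℂ) ^ s.natAbs) (by fun_prop) hg)
    (integral_sphere_monomial_eq_zero hg h)
  filter_upwards [hw, ae_mem_chartDomain] with x hx hxU
  have hne : (Real.cos (x.1 / 2) * Real.sin (x.1 / 2) : ℂ) ≠ 0 := by
    exact_mod_cast (mul_pos (cos_half_fst_pos hxU) (sin_half_fst_pos hxU)).ne'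
  exact (mul_eq_zero.1 hx).resolve_left (pow_ne_zero _ hne)

/-- **The spin-`s` spherical harmonics form a complete orthonormal system of
`L²((0,π)×(−π,π), sin θ dθ dφ)`** (Statement 4). -/
theorem sY_hilbert_basis (s : ℤ) :
    ∃ F : {p : ℤ × ℤ // |s| ≤ p.1 ∧ -p.1 ≤ p.2 ∧ p.2 ≤ p.1} → Lp ℂ 2 sphMeas,
      (∀ i, (F i : ℝ × ℝ → ℂ) =ᵐ[sphMeas] fun x => sY s i.1.1 i.1.2 x) ∧
      Orthonormal ℂ F ∧
      (Submodule.span ℂ (Set.range F)).topologicalClosure = ⊤ := by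
  have hmem : ∀ l m : ℤ, MemLp (sYExt s l m) 2 sphMeas := fun l m =>
    memLp_sphMeas_of_continuous (continuous_sYExt s l m) 2
  have hinner : ∀ (l m : ℤ) (g : Lp ℂ 2 sphMeas), inner ℂ ((hmem l m).toLp) g =
      ∫ x, (starRingEnd ℂ) (sYExt s l m x) * g x ∂sphMeas := by
    intro l m g
    rw [L2.inner_def]
    refine integral_congr_ae ?_
    filter_upwards [(hmem l m).coeFn_toLp] with x hx
    rw [hx, RCLike.inner_apply, mul_comm]
  refine ⟨fun i => (hmem i.1.1 i.1.2).toLp, fun i => ?_, ?_, ?_⟩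
  · exact (hmem _ _).coeFn_toLp.trans (sYExt_ae_eq i.2.1 i.2.2.1)
  · rw [orthonormal_iff_ite]
    rintro ⟨⟨l, m⟩, hi⟩ ⟨⟨l', m'⟩, hj⟩
    rw [hinner]
    calc _ = ∫ x, (starRingEnd ℂ) (sYExt s l m x) * sYExt s l' m' x ∂sphMeas := by
          refine integral_congr_ae ?_
          filter_upwards [(hmem l' m').coeFn_toLp] with x hx
          rw [hx]
      _ = _ := by
          rw [integral_conj_sYExt_mul hi.1 hi.2.1 hi.2.2 hj.1 hj.2.1]
          simp
  · rw [Submodule.topologicalClosure_eq_top_iff, Submodule.eq_bot_iff]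
    intro g hg
    rw [Lp.eq_zero_iff_ae_eq_zero]
    refine ae_eq_zero_of_integral_conj_sYExt_mul (s := s)
      ((Lp.memLp g).integrable (by norm_num)) fun l m hl hm hm' => ?_
    rw [← hinner]
    exact (Submodule.mem_orthogonal _ _).1 hg _
      (Submodule.subset_span ⟨⟨(l, m), hl, hm, hm'⟩, rfl⟩)
end
end
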